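/- arXiv:2311.02383 — 4 statements merged into one kernel-verified Lean document; each statement's English description precedes it below -/
import Mathlib

section
/- For the partition generating function, as z → 0 with Re(z) > 0 in a cone |Im z| ≤ M·Re(z), one has ∏_{n≥1}(1−e^{−nz})^{−1} = √(z/(2π)) · e^{π²/(6z)} · (1 + O(|z|)). -/
open Complex in
lemma aux_transform (z : ℂ) (hz : 0 < z.re) :
    (∏' n : ℕ, (1 - cexp (-(((n : ℂ) + 1) * z))))⁻¹ =
      (z / (2 * (Real.pi : ℂ))) ^ ((1 : ℂ) / 2) * cexp ((Real.pi : ℂ) ^ 2 / (6 * z)) *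
      (cexp (-z / 24) * (∏' n : ℕ, (1 - cexp (-(4 * (Real.pi : ℂ) ^ 2 / z)) ^ (n + 1)))⁻¹) := by
  have hz0 : z ≠ 0 := by rintro rfl; simp at hz
  have hpi : (Real.pi : ℂ) ≠ 0 := by exact_mod_cast Real.pi_ne_zero
  set w : ℂ := z / (2 * (Real.pi : ℂ)) with hw
  have hw' : w = ((2 * Real.pi)⁻¹ : ℝ) * z := by rw [hw]; push_cast; field_simp
  have hwre : 0 < w.re := by
    rw [hw', Complex.re_ofReal_mul]; positivity
  have hw0 : w ≠ 0 := by rintro h; simp [h] at hwre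
  have hzw : z = 2 * Real.pi * w := by rw [hw]; field_simp
  have hmem : I * w ∈ UpperHalfPlane.upperHalfPlaneSet := by
    show 0 < (I * w).im
    simpa using hwre
  have key := ModularForm.eta_comp_eq_csqrt_I_inv hmem
  have hne := ModularForm.eta_tprod_ne_zero hmem
  simp only [Function.comp, Pi.smul_apply, Pi.mul_apply, smul_eq_mul] at key
  have hsq : sqrt (I * w) = sqrt I * w ^ ((1 : ℂ) / 2) := by
    have hI : I ^ ((1 : ℂ) / 2) * w ^ ((1 : ℂ) / 2) = (I * w) ^ ((1 : ℂ) / 2) := by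
      have ha := Complex.abs_arg_lt_pi_div_two_iff.2 (Or.inl hwre)
      rw [abs_lt] at ha
      rw [Complex.cpow_def_of_ne_zero I_ne_zero, Complex.cpow_def_of_ne_zero hw0,
        Complex.cpow_def_of_ne_zero (mul_ne_zero I_ne_zero hw0), Complex.log_mul I_ne_zero hw0,
        ← Complex.exp_add, add_mul]
      rw [Complex.arg_I]
      constructor <;> linarith [ha.1, ha.2]
    simp only [sqrt, ← one_div]
    exact hI.symm
  have hsI : sqrt I ≠ 0 := by simp [sqrt]
  rw [hsq] at key
  have key2 : ModularForm.eta (-1 / (I * w)) = w ^ ((1 : ℂ) / 2) * ModularForm.eta (I * w) := by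
    rw [key]; field_simp
  have e1 : (fun n : ℕ => 1 - ModularForm.eta_q n (I * w)) =
      fun n : ℕ => 1 - cexp (-(((n : ℂ) + 1) * z)) := by
    ext n
    rw [ModularForm.eta_q_eq_cexp, hzw]
    congr 2
    linear_combination (2 * Real.pi * (n + 1) * w : ℂ) * I_mul_I
  have hinv : -1 / (I * w) = I / w := by
    rw [div_eq_div_iff (mul_ne_zero I_ne_zero hw0) hw0]
    linear_combination (-w) * I_mul_I
  have e2 : (fun n : ℕ => 1 - ModularForm.eta_q n (I / w)) =
      fun n : ℕ => 1 - cexp (-(4 * (Real.pi : ℂ) ^ 2 / z)) ^ (n + 1) := by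
    ext n
    rw [ModularForm.eta_q_eq_pow, hzw]
    congr 3
    field_simp
    linear_combination 4 * I_sq
  rw [hinv, ModularForm.eta, ModularForm.eta, e1, e2] at key2
  rw [e1] at hne
  have q1 : Function.Periodic.qParam 24 (I * w) = cexp (-z / 24) := by
    rw [Function.Periodic.qParam, hzw]; congr 1; push_cast
    linear_combination (2 * Real.pi * w / 24 : ℂ) * I_mul_I
  have q2 : Function.Periodic.qParam 24 (I / w) = (cexp ((Real.pi : ℂ) ^ 2 / (6 * z)))⁻¹ := by
    rw [Function.Periodic.qParam, hzw, ← Complex.exp_neg]; congr 1; push_cast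
    field_simp
    linear_combination 24 * I_sq
  rw [q1, q2] at key2
  set P := ∏' n : ℕ, (1 - cexp (-(((n : ℂ) + 1) * z)))
  set Q := ∏' n : ℕ, (1 - cexp (-(4 * (Real.pi : ℂ) ^ 2 / z)) ^ (n + 1))
  have hE := Complex.exp_ne_zero ((Real.pi : ℂ) ^ 2 / (6 * z))
  have hE2 := Complex.exp_ne_zero (-z/24)
  have hwc : w ^ ((1 : ℂ) / 2) ≠ 0 := by simp [Complex.cpow_eq_zero_iff, hw0]
  have hQ : Q = cexp ((Real.pi : ℂ) ^ 2 / (6 * z)) * (w ^ ((1 : ℂ) / 2) * (cexp (-z / 24) * P)) := by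
    rw [← key2]; field_simp
  rw [hQ]
  field_simp

lemma aux_local : ∃ C > (0 : ℝ), ∃ δ > (0 : ℝ), ∀ q : ℂ, ‖q‖ < δ →
    ‖(∏' n : ℕ, (1 - q ^ (n + 1)))⁻¹ - 1‖ ≤ C * ‖q‖ := by
  have hd : DifferentiableAt ℂ (fun q : ℂ => (∏' n : ℕ, (1 - q ^ (n + 1)))⁻¹) 0 := by
    refine DifferentiableAt.inv (ModularForm.differentiableOn_tprod_one_sub_pow.differentiableAt
      (Metric.isOpen_ball.mem_nhds (by simp))) (by simp)
  obtain ⟨C, hC, h⟩ := hd.isBigO_sub.exists_pos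
  rw [Asymptotics.IsBigOWith, Metric.eventually_nhds_iff] at h
  obtain ⟨δ, hδ, h⟩ := h
  refine ⟨C, hC, δ, hδ, fun q hq => ?_⟩
  simpa using h (y := q) (by simpa using hq)


/-- Major-arc asymptotic for the partition generating function: as `z → 0` in the cone
`|Im z| ≤ M Re z`, `∏_{n≥1}(1−e^{−nz})⁻¹ = √(z/(2π)) e^{π²/(6z)} (1 + O(|z|))`. -/
theorem euler_product_major_arc (M : ℝ) (hM : 0 < M) :
    ∃ C > (0 : ℝ), ∃ δ > (0 : ℝ), ∀ z : ℂ, 0 < z.re → |z.im| ≤ M * z.re → ‖z‖ ≤ δ →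
      ‖(∏' n : ℕ, (1 - Complex.exp (-(((n : ℂ) + 1) * z))))⁻¹ -
          (z / (2 * (Real.pi : ℂ))) ^ ((1 : ℂ) / 2) *
            Complex.exp ((Real.pi : ℂ) ^ 2 / (6 * z))‖
        ≤ C * ‖z‖ *
          ‖(z / (2 * (Real.pi : ℂ))) ^ ((1 : ℂ) / 2) *
            Complex.exp ((Real.pi : ℂ) ^ 2 / (6 * z))‖ := by
  obtain ⟨C, hC, δ, hδ, h⟩ := aux_local
  refine ⟨2 * C * (1 + M) + 1, by positivity, min 1 (δ / (2 * (1 + M))), by positivity, ?_⟩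
  intro z hz him hzδ
  have hz1 : ‖z‖ ≤ 1 := hzδ.trans (min_le_left _ _)
  have hz2 : ‖z‖ ≤ δ / (2 * (1 + M)) := hzδ.trans (min_le_right _ _)
  have hz0 : z ≠ 0 := by rintro rfl; simp at hz
  have hn : 0 < ‖z‖ := norm_pos_iff.2 hz0
  have hcone : ‖z‖ ≤ (1 + M) * z.re := by
    have := Complex.norm_le_abs_re_add_abs_im z
    rw [abs_of_pos hz] at this
    linarith
  rw [aux_transform z hz]
  set A := (z / (2 * (Real.pi : ℂ))) ^ ((1 : ℂ) / 2) * Complex.exp ((Real.pi : ℂ) ^ 2 / (6 * z))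
  set q := Complex.exp (-(4 * (Real.pi : ℂ) ^ 2 / z)) with hq
  have hqn : ‖q‖ ≤ (1 + M) * ‖z‖ := by
    rw [hq, Complex.norm_exp]
    have e : (-(4 * (Real.pi : ℂ) ^ 2 / z)).re = -(4 * Real.pi ^ 2 * z.re / ‖z‖ ^ 2) := by
      have : (4 * (Real.pi : ℂ) ^ 2 / z) = ((4 * Real.pi ^ 2 : ℝ) : ℂ) * z⁻¹ := by
        push_cast; rw [div_eq_mul_inv]
      rw [Complex.neg_re, this, Complex.re_ofReal_mul, Complex.inv_re, Complex.normSq_eq_norm_sq]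
      ring
    rw [e, Real.exp_neg]
    set t := 4 * Real.pi ^ 2 * z.re / ‖z‖ ^ 2 with ht
    have htl : ((1 + M) * ‖z‖)⁻¹ ≤ t := by
      rw [ht, inv_le_iff_one_le_mul₀ (by positivity), div_mul_eq_mul_div, le_div_iff₀ (by positivity)]
      have : 1 ≤ 4 * Real.pi ^ 2 := by nlinarith [Real.pi_gt_three]
      have h3 : 0 < (1 + M) * z.re * ‖z‖ := by positivity
      nlinarith [mul_le_mul_of_nonneg_right hcone hn.le]
    have := Real.add_one_le_exp t
    exact inv_le_of_inv_le₀ (by positivity) (by linarith)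
  have hqδ : ‖q‖ < δ := by
    have : (1 + M) * ‖z‖ ≤ δ / 2 := by
      calc _ ≤ (1 + M) * (δ / (2 * (1 + M))) := by gcongr
        _ = _ := by field_simp
    linarith
  have hR := h q hqδ
  set R := (∏' n : ℕ, (1 - q ^ (n + 1)))⁻¹
  have hRz : ‖R - 1‖ ≤ C * (1 + M) * ‖z‖ := by
    calc _ ≤ C * ‖q‖ := hR
      _ ≤ C * ((1 + M) * ‖z‖) := by gcongr
      _ = _ := by ring
  have hn24 : ‖-z / 24‖ = ‖z‖ / 24 := by simp
  have hEz : ‖Complex.exp (-z / 24) - 1‖ ≤ ‖z‖ := by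
    have := Complex.norm_exp_sub_one_le (x := -z / 24) (by rw [hn24]; linarith)
    rw [hn24] at this
    linarith
  set E := Complex.exp (-z / 24)
  have e : A * (E * R) - A = A * ((E - 1) * (R - 1) + (E - 1) + (R - 1)) := by ring
  rw [e, norm_mul, mul_comm]
  gcongr
  calc _ ≤ ‖E - 1‖ * ‖R - 1‖ + ‖E - 1‖ + ‖R - 1‖ := by
        refine (norm_add_le _ _).trans ?_
        gcongr
        refine (norm_add_le _ _).trans ?_
        rw [norm_mul]
    _ ≤ 1 * (C * (1 + M) * ‖z‖) + ‖z‖ + C * (1 + M) * ‖z‖ := by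
        gcongr
        exact hEz.trans hz1
    _ = _ := by ring
end

section
/- On the major arc |Im z| ≤ M·Re(z), as z → 0, ∏_{n≥1}(1−e^{−2nz})^j / ∏_{n≥1}(1−e^{−nz})^{k+j} = 2^{−j/2} (z/(2π))^{k/2} exp(π²(2k+j)/(12z)) (1 + O(|z|)). -/
/-- Euler product. -/
noncomputable def ovF (q : ℂ) : ℂ := ∏' n : ℕ, (1 - q ^ (n + 1))

open Complex in
lemma ovF_eta (z : ℂ) : ModularForm.eta z =
    exp (2 * Real.pi * I * z / 24) * ovF (exp (2 * Real.pi * I * z)) := by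
  simp [ModularForm.eta, ModularForm.eta_q, ovF, Function.Periodic.qParam]
  try rfl

lemma ovF_zero : ovF 0 = 1 := by simp [ovF]

lemma ovF_diff : DifferentiableAt ℂ ovF 0 :=
  (ModularForm.differentiableOn_tprod_one_sub_pow).differentiableAt
    (Metric.ball_mem_nhds 0 one_pos)

open Complex in
lemma ov_upper {z : ℂ} (hz : 0 < z.re) :
    I * (z / (2 * Real.pi)) ∈ UpperHalfPlane.upperHalfPlaneSet := by
  have : I * (z / (2 * Real.pi)) = ((1 / (2 * Real.pi) : ℝ) : ℂ) * (I * z) := by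
    push_cast; ring
  simp only [UpperHalfPlane.upperHalfPlaneSet, Set.mem_ofPred_eq]
  rw [this, im_ofReal_mul]
  have := Real.pi_pos
  simp only [mul_im, I_re, I_im]
  ring_nf
  positivity

open Complex in
lemma ov_eta_I (z : ℂ) : ModularForm.eta (I * (z / (2 * Real.pi))) =
    exp (-z / 24) * ovF (exp (-z)) := by
  have hp : (Real.pi : ℂ) ≠ 0 := by exact_mod_cast Real.pi_ne_zero
  have h : 2 * Real.pi * I * (I * (z / (2 * Real.pi))) = -z := by
    field_simp
    rw [I_sq]; ring
  rw [ovF_eta, h]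

open Complex in
lemma ovF_ne {z : ℂ} (hz : 0 < z.re) : ovF (exp (-z)) ≠ 0 := by
  have h := ModularForm.eta_ne_zero (ov_upper hz)
  rw [ov_eta_I] at h
  exact right_ne_zero_of_mul h

open Complex in
lemma ov_sqrt {w : ℂ} (hw : 0 < w.re) : sqrt (I * w) = sqrt I * sqrt w := by
  have hw0 : w ≠ 0 := by rintro rfl; simp at hw
  have h : log (I * w) = log I + log w := by
    apply log_mul I_ne_zero hw0
    have := abs_lt.1 (abs_arg_lt_pi_div_two_iff.2 (Or.inl hw))
    have hp := Real.pi_pos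
    rw [arg_I]
    constructor <;> linarith [this.1, this.2]
  simp only [sqrt]
  rw [cpow_def_of_ne_zero (mul_ne_zero I_ne_zero hw0), cpow_def_of_ne_zero I_ne_zero,
    cpow_def_of_ne_zero hw0, h, ← exp_add]
  ring_nf

open Complex in
lemma ov_trans {z : ℂ} (hz : 0 < z.re) :
    exp (-(Real.pi : ℂ) ^ 2 / (6 * z)) * ovF (exp (-(4 * Real.pi ^ 2 / z))) =
      sqrt (z / (2 * Real.pi)) * (exp (-z / 24) * ovF (exp (-z))) := by
  have hp : (Real.pi : ℂ) ≠ 0 := by exact_mod_cast Real.pi_ne_zero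
  have hz0 : z ≠ 0 := by rintro rfl; simp at hz
  have h := ModularForm.eta_comp_eq_csqrt_I_inv (ov_upper hz)
  simp only [Function.comp, Pi.smul_apply, Pi.mul_apply, smul_eq_mul] at h
  have e : -1 / (I * (z / (2 * Real.pi))) = I * ((4 * Real.pi ^ 2 / z) / (2 * Real.pi)) := by
    field_simp
    rw [I_sq]; ring
  have hw : 0 < (z / (2 * Real.pi)).re := by
    have : z / (2 * Real.pi) = ((1 / (2 * Real.pi) : ℝ) : ℂ) * z := by
      push_cast; ring
    rw [this, re_ofReal_mul]
    have := Real.pi_pos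
    positivity
  rw [e, ov_eta_I, ov_eta_I, ov_sqrt hw] at h
  have hI : sqrt I ≠ 0 := by simp [sqrt]
  have e2 : -(Real.pi : ℂ) ^ 2 / (6 * z) = -(4 * Real.pi ^ 2 / z) / 24 := by
    field_simp; norm_num
  rw [e2, h]
  field_simp

open Complex in
lemma ov_sqrt2 {w : ℂ} (hw : w ≠ 0) : sqrt (2 * w) = sqrt 2 * sqrt w := by
  have h := log_ofReal_mul (r := 2) two_pos hw
  have h2 : log (2 : ℂ) = (Real.log 2 : ℝ) := by simp
  simp only [sqrt]
  push_cast at h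
  rw [cpow_def_of_ne_zero (mul_ne_zero two_ne_zero hw), cpow_def_of_ne_zero two_ne_zero,
    cpow_def_of_ne_zero hw, h, h2, ← exp_add]
  ring_nf

lemma ov_alg (k j : ℕ) (P1 P2 r s a e F2 F4 : ℂ) (hP1 : P1 ≠ 0) (hr : r ≠ 0) (hs : s ≠ 0)
    (ha : a ≠ 0) (he : e ≠ 0) (hF4 : F4 ≠ 0)
    (h1 : e ^ 2 * F4 = s * (a * P1)) (h2 : e * F2 = r * s * (a ^ 2 * P2)) :
    P2 ^ j / P1 ^ (k + j) = ((r ^ j)⁻¹ * s ^ k * (e⁻¹) ^ (2 * k + j)) *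
      (a ^ (k + j) / a ^ (2 * j) * F2 ^ j / F4 ^ (k + j)) := by
  have h1' : P1 = e ^ 2 * F4 / (s * a) := by field_simp; linear_combination -h1
  have h2' : P2 = e * F2 / (r * s * a ^ 2) := by field_simp; linear_combination -h2
  rw [h1', h2']
  simp only [div_pow, mul_pow, pow_add, pow_mul, inv_pow]
  field_simp
  ring_nf

/-- The error factor. -/
noncomputable def ovG (k j : ℕ) (x : ℂ × ℂ × ℂ) : ℂ :=
  Complex.exp (-x.1 / 24) ^ (k + j) / Complex.exp (-x.1 / 24) ^ (2 * j) * ovF x.2.1 ^ j /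
    ovF x.2.2 ^ (k + j)

lemma ovG_diff (k j : ℕ) : DifferentiableAt ℂ (ovG k j) 0 := by
  unfold ovG
  have h1 : DifferentiableAt ℂ (fun x : ℂ × ℂ × ℂ => ovF x.2.1) 0 :=
    DifferentiableAt.comp (g := ovF) (0 : ℂ × ℂ × ℂ) ovF_diff (by fun_prop)
  have h2 : DifferentiableAt ℂ (fun x : ℂ × ℂ × ℂ => ovF x.2.2) 0 :=
    DifferentiableAt.comp (g := ovF) (0 : ℂ × ℂ × ℂ) ovF_diff (by fun_prop)
  fun_prop (disch := simp [ovF_zero])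

lemma ovG_zero (k j : ℕ) : ovG k j 0 = 1 := by simp [ovG, ovF_zero]

lemma ovG_bound (k j : ℕ) : ∃ C > (0 : ℝ), ∃ δ > (0 : ℝ), ∀ x : ℂ × ℂ × ℂ, ‖x‖ ≤ δ →
    ‖ovG k j x - 1‖ ≤ C * ‖x‖ := by
  obtain ⟨C, hC, h⟩ := (ovG_diff k j).isBigO_sub.exists_pos
  rw [Asymptotics.IsBigOWith, Metric.eventually_nhds_iff] at h
  obtain ⟨ε, hε, h⟩ := h
  refine ⟨C, hC, ε / 2, by positivity, fun x hx => ?_⟩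
  have := h (y := x) (by rw [dist_zero_right]; linarith)
  simpa [ovG_zero] using this

open Complex in
lemma ov_q {M : ℝ} (hM : 0 < M) {z : ℂ} (hz : 0 < z.re) (hi : |z.im| ≤ M * z.re) {c : ℝ}
    (hc : 1 ≤ c) : ‖exp (-((c : ℂ) / z))‖ ≤ (1 + M) * ‖z‖ := by
  have hz0 : z ≠ 0 := by rintro rfl; simp at hz
  have hn : 0 < ‖z‖ := norm_pos_iff.2 hz0
  have h1 : ‖z‖ ≤ (1 + M) * z.re := by
    have := norm_le_abs_re_add_abs_im z
    rw [abs_of_pos hz] at this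
    linarith
  have h2 : (-((c : ℂ) / z)).re = -(c * (z.re / ‖z‖ ^ 2)) := by
    rw [neg_re, div_eq_mul_inv, re_ofReal_mul, inv_re, normSq_eq_norm_sq]
  rw [norm_exp, h2]
  have h3 : ((1 + M) * ‖z‖)⁻¹ ≤ c * (z.re / ‖z‖ ^ 2) := by
    have : ((1 + M) * ‖z‖)⁻¹ ≤ z.re / ‖z‖ ^ 2 := by
      rw [inv_eq_one_div, div_le_div_iff₀ (by positivity) (by positivity)]
      nlinarith
    have h0 : 0 ≤ z.re / ‖z‖ ^ 2 := by positivity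
    nlinarith
  rw [Real.exp_neg]
  apply inv_le_of_inv_le₀ (by positivity)
  linarith [Real.add_one_le_exp (c * (z.re / ‖z‖ ^ 2))]


/-- Major-arc asymptotic of the `(k,j)`-coloured overpartition generating function:
as `z → 0` with `|Im z| ≤ M Re z`,
`∏(1−e^{−2nz})^j / ∏(1−e^{−nz})^{k+j} = 2^{−j/2} (z/(2π))^{k/2} e^{π²(2k+j)/(12z)} (1+O(|z|))`. -/
theorem overpartition_major_arc (k j : ℕ) (hj : 0 < j) (hjk : j ≤ k) (M : ℝ) (hM : 0 < M) :
    ∃ C > (0 : ℝ), ∃ δ > (0 : ℝ), ∀ z : ℂ, 0 < z.re → |z.im| ≤ M * z.re → ‖z‖ ≤ δ →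
      ‖(∏' n : ℕ, (1 - Complex.exp (-(2 * ((n : ℂ) + 1) * z)))) ^ j /
            (∏' n : ℕ, (1 - Complex.exp (-(((n : ℂ) + 1) * z)))) ^ (k + j) -
          (2 : ℂ) ^ (-(j : ℂ) / 2) * (z / (2 * (Real.pi : ℂ))) ^ ((k : ℂ) / 2) *
            Complex.exp ((Real.pi : ℂ) ^ 2 * (2 * k + j) / (12 * z))‖
        ≤ C * ‖z‖ *
          ‖(2 : ℂ) ^ (-(j : ℂ) / 2) * (z / (2 * (Real.pi : ℂ))) ^ ((k : ℂ) / 2) *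
            Complex.exp ((Real.pi : ℂ) ^ 2 * (2 * k + j) / (12 * z))‖ := by
  obtain ⟨C, hC, δ, hδ, h⟩ := ovG_bound k j
  refine ⟨C * (1 + M), by positivity, δ / (1 + M), by positivity, fun z hz hi hzδ => ?_⟩
  have hz0 : z ≠ 0 := by rintro rfl; simp at hz
  have hp : (Real.pi : ℂ) ≠ 0 := by exact_mod_cast Real.pi_ne_zero
  have hpi : (1 : ℝ) ≤ Real.pi ^ 2 := by nlinarith [Real.pi_gt_three]
  have hx : ‖((z, Complex.exp (-(2 * Real.pi ^ 2 / z)), Complex.exp (-(4 * Real.pi ^ 2 / z))) :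
      ℂ × ℂ × ℂ)‖ ≤ (1 + M) * ‖z‖ := by
    refine max_le ?_ (max_le ?_ ?_)
    · change ‖z‖ ≤ _
      nlinarith [norm_nonneg z]
    · have := ov_q hM hz hi (c := 2 * Real.pi ^ 2) (by linarith)
      push_cast at this
      exact this
    · have := ov_q hM hz hi (c := 4 * Real.pi ^ 2) (by linarith)
      push_cast at this
      exact this
  have hG := h _ (hx.trans (by rw [le_div_iff₀ (by positivity)] at hzδ; linarith))
  have hP1 : (∏' n : ℕ, (1 - Complex.exp (-(((n : ℂ) + 1) * z)))) = ovF (Complex.exp (-z)) := by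
    unfold ovF
    congr 1; ext n
    rw [← Complex.exp_nat_mul]
    push_cast; ring_nf
  have hP2 : (∏' n : ℕ, (1 - Complex.exp (-(2 * ((n : ℂ) + 1) * z)))) =
      ovF (Complex.exp (-(2 * z))) := by
    unfold ovF
    congr 1; ext n
    rw [← Complex.exp_nat_mul]
    push_cast; ring_nf
  have hw : z / (2 * (Real.pi : ℂ)) ≠ 0 := div_ne_zero hz0 (mul_ne_zero two_ne_zero hp)
  have t1 := ov_trans hz
  have t2 := ov_trans (z := 2 * z) (by simpa using hz)
  have r1 : (2 : ℂ) ^ (-(j : ℂ) / 2) = (Complex.sqrt 2 ^ j)⁻¹ := by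
    rw [Complex.sqrt, ← Complex.cpow_nat_mul, ← Complex.cpow_neg]
    congr 1; ring
  have r2 : (z / (2 * (Real.pi : ℂ))) ^ ((k : ℂ) / 2) = Complex.sqrt (z / (2 * Real.pi)) ^ k := by
    rw [Complex.sqrt, ← Complex.cpow_nat_mul]
    congr 1
  have r3 : Complex.exp ((Real.pi : ℂ) ^ 2 * (2 * k + j) / (12 * z)) =
      (Complex.exp (-(Real.pi : ℂ) ^ 2 / (12 * z)))⁻¹ ^ (2 * k + j) := by
    rw [← Complex.exp_neg, ← Complex.exp_nat_mul]
    congr 1; push_cast; ring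
  have key := ov_alg k j (ovF (Complex.exp (-z))) (ovF (Complex.exp (-(2 * z))))
    (Complex.sqrt 2) (Complex.sqrt (z / (2 * Real.pi))) (Complex.exp (-z / 24))
    (Complex.exp (-(Real.pi : ℂ) ^ 2 / (12 * z)))
    (ovF (Complex.exp (-(2 * Real.pi ^ 2 / z)))) (ovF (Complex.exp (-(4 * Real.pi ^ 2 / z))))
    (ovF_ne hz) (by simp [Complex.sqrt]) (by simpa [Complex.sqrt] using hw)
    (Complex.exp_ne_zero _) (Complex.exp_ne_zero _)
    (by
      intro h0
      rw [h0, mul_zero] at t1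
      have := ovF_ne hz
      have h3 : Complex.sqrt (z / (2 * Real.pi)) ≠ 0 := by
        simpa [Complex.sqrt] using hw
      exact mul_ne_zero h3 (mul_ne_zero (Complex.exp_ne_zero _) this) t1.symm)
    (by
      rw [← t1, ← Complex.exp_nat_mul]
      congr 2; push_cast; field_simp; norm_num)
    (by
      rw [← ov_sqrt2 hw, ← Complex.exp_nat_mul]
      have u1 : 2 * (z / (2 * (Real.pi : ℂ))) = 2 * z / (2 * Real.pi) := by ring
      have u2 : ((2 : ℕ) : ℂ) * (-z / 24) = -(2 * z) / 24 := by push_cast; ring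
      have u3 : -(Real.pi : ℂ) ^ 2 / (12 * z) = -Real.pi ^ 2 / (6 * (2 * z)) := by ring
      have u4 : 2 * (Real.pi : ℂ) ^ 2 / z = 4 * Real.pi ^ 2 / (2 * z) := by
        field_simp; norm_num
      rw [u1, u2, u3, u4]
      exact t2)
  rw [hP1, hP2, r1, r2, r3, key]
  set T := (Complex.sqrt 2 ^ j)⁻¹ * Complex.sqrt (z / (2 * Real.pi)) ^ k *
    (Complex.exp (-(Real.pi : ℂ) ^ 2 / (12 * z)))⁻¹ ^ (2 * k + j) with hT
  change ‖T * ovG k j (z, Complex.exp (-(2 * Real.pi ^ 2 / z)),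
    Complex.exp (-(4 * Real.pi ^ 2 / z))) - T‖ ≤ _
  rw [show ∀ g : ℂ, T * g - T = (g - 1) * T by intro g; ring, norm_mul]
  apply mul_le_mul_of_nonneg_right _ (norm_nonneg _)
  calc _ ≤ _ := hG
    _ ≤ C * ((1 + M) * ‖z‖) := by gcongr
    _ = _ := by ring
end

section
/- Let ζ be a primitive b-th root of unity with b ≥ 2. Then as z → 0 in a cone D_θ = {re^{iα} : r ≥ 0, |α| ≤ θ} with 0 ≤ θ < π/2, ∏_{n≥1}(1 − ζ e^{−nz}) = (1−ζ)^{−1/2} · exp(−ζΦ(ζ,2,1)/z) · (1 + O(|z|)), where Φ(ζ,2,1) = ∑_{n≥0} ζ^n/(n+1)² so that ζΦ(ζ,2,1) = Li₂(ζ). -/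
open Complex Filter Topology

lemma aux_cone (ζ : ℂ) (h1 : ‖ζ‖ = 1) (hne : ζ ≠ 1) (c : ℝ) (hc : 0 < c) :
    ∃ κ > (0:ℝ), ∀ w : ℂ, c * ‖w‖ ≤ w.re → κ ≤ ‖1 - ζ * exp (-w)‖ := by
  have hcont : ContinuousAt (fun w : ℂ => ‖1 - ζ * exp (-w)‖) 0 := by fun_prop
  have hpos : 0 < ‖1 - ζ‖ := norm_pos_iff.2 (sub_ne_zero.2 (Ne.symm hne))
  have h2 : ∀ᶠ w in 𝓝 (0:ℂ), ‖1 - ζ‖ / 2 < ‖1 - ζ * exp (-w)‖ := by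
    apply hcont.eventually_const_lt
    simp; exact sub_ne_zero.2 (Ne.symm hne)
  obtain ⟨ρ, hρ, hb⟩ := Metric.eventually_nhds_iff.1 h2
  have he : Real.exp (-(c*ρ)) < 1 := by
    rw [Real.exp_lt_one_iff]; nlinarith [mul_pos hc hρ]
  refine ⟨min (‖1 - ζ‖ / 2) (1 - Real.exp (-(c*ρ))), lt_min (by positivity) (by linarith), ?_⟩
  intro w hw
  by_cases h : ‖w‖ < ρ
  · exact (min_le_left _ _).trans (hb (by simpa using h)).le
  · refine (min_le_right _ _).trans ?_
    have h3 := norm_sub_norm_le (1:ℂ) (ζ * exp (-w))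
    rw [norm_mul, h1, norm_exp] at h3
    simp only [norm_one, one_mul, neg_re] at h3
    have : Real.exp (-w.re) ≤ Real.exp (-(c*ρ)) := by
      apply Real.exp_le_exp.2
      nlinarith
    linarith

/-- dilog -/
noncomputable def LL (ζ w : ℂ) : ℂ := ∑' n : ℕ, (ζ * exp (-w)) ^ (n+1) / ((n:ℂ)+1)^2

lemma summ2 : Summable (fun n : ℕ => 1 / ((n:ℝ)+1)^2) := by
  have := (summable_nat_add_iff 1).2 (Real.summable_one_div_nat_pow.2 (one_lt_two))
  simpa using this

lemma nrm_x (ζ w : ℂ) (h1 : ‖ζ‖ = 1) : ‖ζ * exp (-w)‖ = Real.exp (-w.re) := by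
  rw [norm_mul, h1, norm_exp]; simp

lemma nrm_np (n : ℕ) : ‖((n:ℂ)+1)‖ = (n:ℝ)+1 := by
  have : ((n:ℂ)+1) = ((n+1:ℕ):ℂ) := by push_cast; rfl
  rw [this, norm_natCast]; push_cast; rfl

lemma LL_term (ζ w : ℂ) (h1 : ‖ζ‖ = 1) (hw : 0 ≤ w.re) (n : ℕ) :
    ‖(ζ * exp (-w)) ^ (n+1) / ((n:ℂ)+1)^2‖ ≤ Real.exp (-w.re) * (1 / ((n:ℝ)+1)^2) := by
  rw [norm_div, norm_pow, norm_pow, nrm_x ζ w h1, nrm_np, div_eq_mul_one_div]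
  gcongr
  rw [pow_succ]
  have : Real.exp (-w.re) ^ n ≤ 1 := pow_le_one₀ (by positivity) (by simpa using hw)
  nlinarith [Real.exp_pos (-w.re)]

lemma LL_cont (ζ : ℂ) (h1 : ‖ζ‖ = 1) : ContinuousOn (LL ζ) {w | 0 ≤ w.re} := by
  unfold LL
  refine continuousOn_tsum (fun n => by fun_prop) summ2 ?_
  intro n w hw
  have hw : 0 ≤ w.re := hw
  refine (LL_term ζ w h1 hw n).trans ?_
  have : Real.exp (-w.re) ≤ 1 := by simpa using hw
  exact mul_le_of_le_one_left (by positivity) this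

lemma LL_bound (ζ w : ℂ) (h1 : ‖ζ‖ = 1) (hw : 0 ≤ w.re) :
    ‖LL ζ w‖ ≤ Real.exp (-w.re) * ∑' n : ℕ, (1 / ((n:ℝ)+1)^2) := by
  unfold LL
  rw [← tsum_mul_left]
  exact tsum_of_norm_bounded (summ2.mul_left _).hasSum (LL_term ζ w h1 hw)

lemma LL_deriv (ζ w : ℂ) (h1 : ‖ζ‖ = 1) (hw : 0 < w.re) :
    HasDerivAt (LL ζ) (log (1 - ζ * exp (-w))) w := by
  have hlt : ‖ζ * exp (-w)‖ < 1 := by rw [nrm_x ζ w h1]; simpa using hw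
  have hs := hasSum_taylorSeries_neg_log hlt
  rw [← hasSum_nat_add_iff' 1] at hs
  have key : HasDerivAt (LL ζ) (∑' n : ℕ, -((ζ * exp (-w)) ^ (n+1) / ((n:ℂ)+1))) w := by
    unfold LL
    have hr : 0 < w.re / 2 := by linarith
    refine hasDerivAt_tsum_of_isPreconnected (u := fun n : ℕ => Real.exp (-(w.re/2)) ^ (n+1))
      (t := {v : ℂ | w.re / 2 < v.re}) (y₀ := w) (y := w)
      (g := fun n v => (ζ * exp (-v)) ^ (n+1) / ((n:ℂ)+1)^2)
      (g' := fun n v => -((ζ * exp (-v)) ^ (n+1) / ((n:ℂ)+1)))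
      ?_ ?_ ?_ ?_ ?_ ?_ ?_ ?_
    · exact (summable_nat_add_iff 1).2 (summable_geometric_of_lt_one (by positivity) (by simpa using hw))
    · exact isOpen_lt continuous_const continuous_re
    · exact (convex_halfSpace_re_gt _).isPreconnected
    · intro n v hv
      have hn : ((n:ℂ)+1) ≠ 0 := Nat.cast_add_one_ne_zero n
      have := ((((hasDerivAt_id v).neg.cexp).const_mul ζ).pow (n+1)).div_const (((n:ℂ)+1)^2)
      convert! this using 1
      simp
      field_simp
      ring
    · intro n v hv
      have hv : w.re / 2 < v.re := hv
      rw [norm_neg, norm_div, norm_pow, nrm_x ζ v h1, nrm_np]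
      refine (div_le_self (by positivity) (by linarith [(Nat.cast_nonneg n : (0:ℝ) ≤ n)])).trans ?_
      gcongr
    · show w.re/2 < w.re
      linarith
    · exact Summable.of_norm_bounded (summ2.mul_left _) (LL_term ζ w h1 hw.le)
    · show w.re/2 < w.re
      linarith
  convert! key using 1
  rw [tsum_neg]
  simp at hs
  rw [hs.tsum_eq]; simp

lemma trap (φ φ' φ'' Λ : ℝ → ℂ) (a M : ℝ) (hM : 0 ≤ M)
    (h1 : ∀ t ∈ Set.Icc a (a+1), HasDerivAt φ (φ' t) t)
    (h2 : ∀ t ∈ Set.Icc a (a+1), HasDerivAt φ' (φ'' t) t)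
    (hb : ∀ t ∈ Set.Icc a (a+1), ‖φ'' t‖ ≤ M)
    (hc : ContinuousOn Λ (Set.Icc a (a+1)))
    (h3 : ∀ t ∈ Set.Ioo a (a+1), HasDerivAt Λ (φ t) t) :
    ‖(φ a + φ (a+1)) / 2 - (Λ (a+1) - Λ a)‖ ≤ M / 2 := by
  set E1 : ℝ → ℂ := fun t => (φ a - φ t) / 2 + ((t - a : ℝ):ℂ) * φ' t / 2 with hE1
  set E : ℝ → ℂ := fun t => ((t - a : ℝ):ℂ) * (φ a + φ t) / 2 - (Λ t - Λ a) with hE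
  have hid : ∀ t : ℝ, HasDerivAt (fun t : ℝ => ((t - a : ℝ):ℂ)) 1 t := by
    intro t
    simpa using ((hasDerivAt_id t).sub_const a).ofReal_comp
  have d1 : ∀ t ∈ Set.Icc a (a+1), HasDerivAt E1 (((t - a : ℝ):ℂ) * φ'' t / 2) t := by
    intro t ht
    have := (((h1 t ht).const_sub (φ a)).div_const 2).add (((hid t).mul (h2 t ht)).div_const 2)
    convert! this using 1
    ring
  have d2 : ∀ t ∈ Set.Ioo a (a+1), HasDerivAt E (E1 t) t := by
    intro t ht
    have := ((((hid t).mul ((h1 t (Set.Ioo_subset_Icc_self ht)).const_add (φ a))).div_const 2)).sub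
      ((h3 t ht).sub_const (Λ a))
    convert! this using 1
    simp only [hE1]
    ring
  have b1 : ∀ t ∈ Set.Icc a (a+1), ‖E1 t‖ ≤ M / 2 := by
    intro t ht
    have hz : E1 a = 0 := by simp [hE1]
    have := (convex_Icc a (a+1)).norm_image_sub_le_of_norm_hasDerivWithin_le (C := M/2)
      (fun s hs => (d1 s hs).hasDerivWithinAt) (fun s hs => ?_) 
      (Set.left_mem_Icc.2 (by linarith)) ht
    · rw [hz, sub_zero] at this
      refine this.trans ?_
      rw [Real.norm_eq_abs, abs_of_nonneg (by linarith [ht.1])]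
      nlinarith [ht.2]
    · rw [norm_div, norm_mul, norm_real, Real.norm_eq_abs, abs_of_nonneg (by linarith [hs.1])]
      have := hb s hs
      have h5 : s - a ≤ 1 := by linarith [hs.2]
      have h6 : 0 ≤ s - a := by linarith [hs.1]
      simp only [norm_ofNat]
      nlinarith [norm_nonneg (φ'' s)]
  have cE1 : ContinuousOn E1 (Set.Icc a (a+1)) := fun t ht => (d1 t ht).continuousAt.continuousWithinAt
  have cφ : ContinuousOn φ (Set.Icc a (a+1)) := fun t ht => (h1 t ht).continuousAt.continuousWithinAt
  have cE : ContinuousOn E (Set.Icc a (a+1)) := by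
    simp only [hE]
    fun_prop
  have hint := intervalIntegral.integral_eq_sub_of_hasDerivAt_of_le (by linarith) cE d2
    (cE1.intervalIntegrable_of_Icc (by linarith))
  have hfin := intervalIntegral.norm_integral_le_of_norm_le_const (a := a) (b := a+1) (f := E1) (C := M/2)
    (fun t ht => b1 t (by
      rw [Set.uIoc_of_le (by linarith)] at ht
      exact Set.Ioc_subset_Icc_self ht))
  rw [hint] at hfin
  simpa [hE] using hfin

lemma slit (ζ w : ℂ) (h1 : ‖ζ‖ = 1) (hne : ζ * exp (-w) ≠ 1) (hw : 0 ≤ w.re) :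
    1 - ζ * exp (-w) ∈ slitPlane := by
  left
  have h := nrm_x ζ w h1
  have h2 : ‖ζ * exp (-w)‖ ≤ 1 := by rw [h]; simpa using hw
  generalize ζ * exp (-w) = x at *
  have h3 := (re_le_norm x).trans h2
  rcases h3.lt_or_eq with h4 | h4
  · simpa using h4
  · exfalso; apply hne
    have h5 : x.re ^2 + x.im ^2 ≤ 1 := by
      have := Complex.sq_norm x
      rw [normSq_apply] at this
      nlinarith [norm_nonneg x]
    have : x.im = 0 := by nlinarith
    apply Complex.ext <;> simp [*]

lemma main_bd (ζ : ℂ) (h1 : ‖ζ‖ = 1) (c κ : ℝ) (hc : 0 < c) (hκ : 0 < κ)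
    (hK : ∀ w : ℂ, c * ‖w‖ ≤ w.re → κ ≤ ‖1 - ζ * exp (-w)‖)
    (z : ℂ) (hz : z ≠ 0) (hcz : c * ‖z‖ ≤ z.re) (hz1 : z.re ≤ 1) :
    ∃ d : ℂ, ‖d‖ ≤ ‖z‖ / (κ^2 * c) ∧
      HasSum (fun n : ℕ => log (1 - ζ * exp (-(((n:ℂ)+1) * z))))
        (d - log (1 - ζ) / 2 - LL ζ 0 / z) := by
  have hzn : 0 < ‖z‖ := norm_pos_iff.2 hz
  have hx : 0 < z.re := lt_of_lt_of_le (by positivity) hcz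
  set φ : ℝ → ℂ := fun t => log (1 - ζ * exp (-((t:ℂ) * z))) with hφ
  set φ' : ℝ → ℂ := fun t => z * (ζ * exp (-((t:ℂ) * z))) / (1 - ζ * exp (-((t:ℂ) * z))) with hφ'
  set φ'' : ℝ → ℂ := fun t => -(z^2 * (ζ * exp (-((t:ℂ) * z))) / (1 - ζ * exp (-((t:ℂ) * z)))^2) with hφ''
  set Λ : ℝ → ℂ := fun t => LL ζ ((t:ℂ) * z) / z with hΛ
  have hre : ∀ t : ℝ, ((t:ℂ) * z).re = t * z.re := by intro t; simp
  have hlow : ∀ t : ℝ, 0 ≤ t → κ ≤ ‖1 - ζ * exp (-((t:ℂ) * z))‖ := by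
    intro t ht
    apply hK
    rw [hre, norm_mul, norm_real, Real.norm_eq_abs, abs_of_nonneg ht]
    nlinarith
  have hne0 : ∀ t : ℝ, 0 ≤ t → 1 - ζ * exp (-((t:ℂ) * z)) ≠ 0 := by
    intro t ht h
    have := hlow t ht
    rw [h, norm_zero] at this
    linarith
  have hslit : ∀ t : ℝ, 0 ≤ t → 1 - ζ * exp (-((t:ℂ) * z)) ∈ slitPlane := by
    intro t ht
    apply slit ζ _ h1
    · intro h; exact hne0 t ht (by rw [h, sub_self])
    · rw [hre]; positivity
  have hlin : ∀ t : ℝ, HasDerivAt (fun t : ℝ => (t:ℂ) * z) z t := by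
    intro t
    simpa using ((hasDerivAt_id t).ofReal_comp).mul_const z
  have hX : ∀ t : ℝ, HasDerivAt (fun t : ℝ => ζ * exp (-((t:ℂ) * z))) (-(z * (ζ * exp (-((t:ℂ) * z))))) t := by
    intro t
    convert! ((hlin t).neg.cexp).const_mul ζ using 1
    simp only [Pi.neg_apply]
    ring
  have H1 : ∀ t : ℝ, 0 ≤ t → HasDerivAt φ (φ' t) t := by
    intro t ht
    convert! ((hX t).const_sub 1).clog_real (hslit t ht) using 1
    simp [hφ']
  have H2 : ∀ t : ℝ, 0 ≤ t → HasDerivAt φ' (φ'' t) t := by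
    intro t ht
    have h0 := hne0 t ht
    convert! ((hX t).const_mul z).div ((hX t).const_sub 1) h0 using 1
    simp only [hφ'']
    field_simp
    ring
  have H3 : ∀ t : ℝ, 0 < t → HasDerivAt Λ (φ t) t := by
    intro t ht
    have h5 := LL_deriv ζ ((t:ℂ)*z) h1 (by rw [hre]; positivity)
    have := (HasDerivAt.comp t h5 (hlin t)).div_const z
    convert! this using 1
    field_simp
    rfl
  have HC : ContinuousOn Λ (Set.Ici 0) := by
    simp only [hΛ]
    refine ContinuousOn.div_const ?_ z
    refine (LL_cont ζ h1).comp (by fun_prop) ?_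
    intro t ht
    show 0 ≤ ((t:ℂ) * z).re
    rw [hre]; exact mul_nonneg ht hx.le
  have HB : ∀ a t : ℝ, 0 ≤ a → a ≤ t → ‖φ'' t‖ ≤ ‖z‖^2 / κ^2 * Real.exp (-(a * z.re)) := by
    intro a t ha hat
    simp only [hφ'']
    rw [norm_neg, norm_div, norm_mul, nrm_x _ _ h1, norm_pow, norm_pow, hre]
    have := hlow t (ha.trans hat)
    have h6 : Real.exp (-(t * z.re)) ≤ Real.exp (-(a * z.re)) := by
      apply Real.exp_le_exp.2; nlinarith
    calc _ ≤ ‖z‖^2 * Real.exp (-(a * z.re)) / κ^2 := by gcongr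
      _ = _ := by ring
  have HT : ∀ n : ℕ, ‖(φ n + φ (n+1)) / 2 - (Λ (n+1) - Λ n)‖ ≤ ‖z‖^2 / κ^2 / 2 * Real.exp (-z.re) ^ n := by
    intro n
    have hn : (0:ℝ) ≤ n := Nat.cast_nonneg n
    have := trap φ φ' φ'' Λ n (‖z‖^2 / κ^2 * Real.exp (-(n * z.re))) (by positivity)
      (fun t ht => H1 t (hn.trans ht.1)) (fun t ht => H2 t (hn.trans ht.1))
      (fun t ht => HB n t hn ht.1) (HC.mono (fun t ht => hn.trans ht.1))
      (fun t ht => H3 t (hn.trans_lt ht.1))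
    refine this.trans (le_of_eq ?_)
    rw [← Real.exp_nat_mul]
    ring_nf
  have hq1 : Real.exp (-z.re) < 1 := by simpa using hx
  have hq2 : z.re / 2 ≤ 1 - Real.exp (-z.re) := by
    have h7 := Real.add_one_le_exp z.re
    have h8 : Real.exp z.re * Real.exp (-z.re) = 1 := by rw [← Real.exp_add]; simp
    nlinarith [Real.exp_pos (-z.re)]
  -- summability
  have hsum : Summable (fun n : ℕ => log (1 - ζ * exp (-(((n:ℂ)+1) * z)))) := by
    have : Summable (fun n : ℕ => -(ζ * exp (-(((n:ℂ)+1) * z)))) := by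
      apply Summable.of_norm
      have h9 : Summable (fun n : ℕ => Real.exp (-z.re) ^ (n+1)) :=
        (summable_nat_add_iff 1).2 (summable_geometric_of_lt_one (by positivity) hq1)
      convert! h9 using 2 with n
      rw [norm_neg, nrm_x _ _ h1, ← Real.exp_nat_mul]
      congr 1
      have := hre (n+1)
      push_cast at this ⊢
      rw [this]; ring
    simpa [sub_eq_add_neg] using Complex.summable_log_one_add_of_summable this
  obtain ⟨S, hS⟩ := hsum
  refine ⟨S + log (1 - ζ) / 2 + LL ζ 0 / z, ?_, by convert! hS using 1; ring⟩
  have hpart : ∀ N : ℕ, ∑ n ∈ Finset.range N, ((φ n + φ (n+1)) / 2 - (Λ (n+1) - Λ n)) =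
      ∑ n ∈ Finset.range N, log (1 - ζ * exp (-(((n:ℂ)+1) * z))) + φ 0 / 2 - φ N / 2 - (Λ N - Λ 0) := by
    intro N
    induction N with
    | zero => simp
    | succ N ih =>
      rw [Finset.sum_range_succ, ih, Finset.sum_range_succ]
      have : log (1 - ζ * exp (-(((N:ℂ)+1) * z))) = φ (N+1) := by simp [hφ]
      rw [this]; push_cast; ring
  have hexp : Tendsto (fun N : ℕ => Real.exp (-((N:ℝ) * z.re))) atTop (𝓝 0) := by
    have := tendsto_pow_atTop_nhds_zero_of_lt_one (Real.exp_pos (-z.re)).le hq1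
    convert! this using 2 with N
    rw [← Real.exp_nat_mul]; ring_nf
  have hφlim : Tendsto (fun N : ℕ => φ N) atTop (𝓝 0) := by
    have h10 : Tendsto (fun N : ℕ => ζ * exp (-(((N:ℝ):ℂ) * z))) atTop (𝓝 0) := by
      rw [tendsto_zero_iff_norm_tendsto_zero]
      convert! hexp using 2 with N
      rw [nrm_x _ _ h1, hre]
    have h11 := (h10.const_sub 1).clog (by simp)
    simpa [hφ] using h11
  have hΛlim : Tendsto (fun N : ℕ => Λ N) atTop (𝓝 0) := by
    have h10 : Tendsto (fun N : ℕ => LL ζ (((N:ℝ):ℂ) * z)) atTop (𝓝 0) := by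
      have h12 := hexp.mul_const (∑' n : ℕ, (1 / ((n:ℝ)+1)^2))
      rw [zero_mul] at h12
      refine squeeze_zero_norm (fun N => ?_) h12
      have := LL_bound ζ (((N:ℝ):ℂ) * z) h1 (by rw [hre]; positivity)
      rwa [hre] at this
    simpa [hΛ] using h10.div_const z
  have hlim := (((hS.tendsto_sum_nat).add_const (φ 0 / 2)).sub (hφlim.div_const 2)).sub (hΛlim.sub_const (Λ 0))
  have hd : S + log (1 - ζ) / 2 + LL ζ 0 / z = S + φ 0 / 2 - 0 / 2 - (0 - Λ 0) := by
    simp [hφ, hΛ]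
  rw [hd]
  refine le_of_tendsto hlim.norm (Eventually.of_forall fun N => ?_)
  rw [← hpart]
  refine (norm_sum_le_of_le _ (fun n _ => HT n)).trans ?_
  rw [← Finset.mul_sum]
  have hg : ∑ n ∈ Finset.range N, Real.exp (-z.re) ^ n ≤ (1 - Real.exp (-z.re))⁻¹ := by
    rw [← tsum_geometric_of_lt_one (by positivity) hq1]
    exact (summable_geometric_of_lt_one (by positivity) hq1).sum_le_tsum _ (fun _ _ => by positivity)
  have hg2 : (1 - Real.exp (-z.re))⁻¹ ≤ (c * ‖z‖ / 2)⁻¹ := by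
    gcongr
    linarith
  calc _ ≤ ‖z‖^2 / κ^2 / 2 * (c * ‖z‖ / 2)⁻¹ := by gcongr; exact hg.trans hg2
    _ = _ := by field_simp

/-- Asymptotic for `F₁(ζ; e^{−z}) = ∏_{n≥1}(1 − ζe^{−nz})` at a primitive `b`-th root of
unity `ζ`, `b ≥ 2`: as `z → 0` in the cone `D_θ = {re^{iα} : r ≥ 0, |α| ≤ θ}` with
`0 ≤ θ < π/2`, one has
`F₁(ζ;e^{−z}) = (1−ζ)^{−1/2} e^{−ζΦ(ζ,2,1)/z}(1+O(|z|))`, where `Φ(ζ,2,1) = ∑_{n≥0} ζ^n/(n+1)²`. -/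
theorem F1_asymptotic (b : ℕ) (hb : 2 ≤ b) (ζ : ℂ) (hζ : IsPrimitiveRoot ζ b)
    (θ : ℝ) (hθ0 : 0 ≤ θ) (hθ : θ < Real.pi / 2) :
    ∃ C > (0 : ℝ), ∃ δ > (0 : ℝ), ∀ z : ℂ, z ≠ 0 → |Complex.arg z| ≤ θ → ‖z‖ ≤ δ →
      ‖(∏' n : ℕ, (1 - ζ * Complex.exp (-(((n : ℂ) + 1) * z)))) -
          (1 - ζ) ^ (-(1 : ℂ) / 2) *
            Complex.exp (-(ζ * ∑' n : ℕ, ζ ^ n / ((n : ℂ) + 1) ^ 2) / z)‖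
        ≤ C * ‖z‖ *
          ‖(1 - ζ) ^ (-(1 : ℂ) / 2) *
            Complex.exp (-(ζ * ∑' n : ℕ, ζ ^ n / ((n : ℂ) + 1) ^ 2) / z)‖ := by
  have h1 : ‖ζ‖ = 1 := hζ.norm'_eq_one (by omega)
  have hne : ζ ≠ 1 := hζ.ne_one (by omega)
  have hc : 0 < Real.cos θ := Real.cos_pos_of_mem_Ioo ⟨by linarith [Real.pi_pos], hθ⟩
  obtain ⟨κ, hκ, hK⟩ := aux_cone ζ h1 hne _ hc
  set c := Real.cos θ with hcdef
  refine ⟨2 / (κ^2 * c), by positivity, min 1 (κ^2 * c), by positivity, ?_⟩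
  intro z hz harg hzδ
  have hcz : c * ‖z‖ ≤ z.re := by
    rw [← norm_mul_cos_arg z, mul_comm]
    gcongr
    rw [← Real.cos_abs (arg z)]
    exact Real.cos_le_cos_of_nonneg_of_le_pi (abs_nonneg _) (by linarith [Real.pi_pos]) harg
  obtain ⟨d, hd, hS⟩ := main_bd ζ h1 c κ hc hκ hK z hz hcz
    ((re_le_norm z).trans (hzδ.trans (min_le_left _ _)))
  have hfac : ∀ n : ℕ, 1 - ζ * exp (-(((n : ℂ) + 1) * z)) ≠ 0 := by
    intro n h
    have := hK (((n:ℂ)+1) * z) (by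
      rw [norm_mul, nrm_np]
      have : (((n:ℂ)+1) * z).re = ((n:ℝ)+1) * z.re := by simp
      rw [this]
      have : (0:ℝ) ≤ (n:ℝ)+1 := by positivity
      nlinarith)
    rw [h, norm_zero] at this
    linarith
  have hprod := Complex.cexp_tsum_eq_tprod hfac hS.summable
  rw [← hprod, hS.tsum_eq]
  have hL : ζ * ∑' n : ℕ, ζ ^ n / ((n : ℂ) + 1) ^ 2 = LL ζ 0 := by
    unfold LL
    rw [← tsum_mul_left]
    congr 1; ext n
    simp; ring
  rw [hL, cpow_def_of_ne_zero (sub_ne_zero.2 (Ne.symm hne)), ← exp_add]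
  have hQ : exp (d - log (1 - ζ) / 2 - LL ζ 0 / z) =
      exp (log (1 - ζ) * (-1/2) + -LL ζ 0 / z) * exp d := by
    rw [← exp_add]; congr 1; ring
  rw [hQ]
  set Q := exp (log (1 - ζ) * (-1/2) + -LL ζ 0 / z)
  have hd1 : ‖d‖ ≤ 1 := hd.trans (by
    rw [div_le_one (by positivity)]; exact hzδ.trans (min_le_right _ _))
  have := Complex.norm_exp_sub_one_le hd1
  calc ‖Q * exp d - Q‖ = ‖exp d - 1‖ * ‖Q‖ := by rw [← norm_mul]; congr 1; ring
    _ ≤ (2 * (‖z‖ / (κ^2 * c))) * ‖Q‖ := by gcongr; linarith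
    _ = _ := by ring
end

section
/- For integers 0 < j ≤ k, the number of (k,j)-coloured overpartitions satisfies p̄_{k,j}(n) = (2k+j)^{(k+1)/4} / (2^{(2k+j+3)/2} · 3^{(k+1)/4} · n^{(k+3)/4}) · e^{π√((2k+j)n/3)} · (1 + O(n^{−1/2})) as n → ∞. -/
/-- A `(k,j)`-coloured overpartition of `n`: a partition of `n` where each part gets one of
`k` colours, and for each of the `j` distinguished colours (the colours `< j`), the first
occurrence of any part in that colour may be overlined. -/
structure ColouredOverpartition (k j n : ℕ) where
  parts : Multiset (ℕ × Fin k)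
  parts_pos : ∀ p ∈ parts, 0 < p.1
  overlined : Finset (ℕ × Fin k)
  overlined_mem : ∀ p ∈ overlined, p ∈ parts ∧ (p.2 : ℕ) < j
  parts_sum : (parts.map Prod.fst).sum = n


namespace CO
open Finset

/-- local factor -/
noncomputable def loc (k j : ℕ) (i : ℕ × Fin k) : PowerSeries ℕ :=
  PowerSeries.mk fun m => if i.1 ∣ m then (if m ≠ 0 ∧ (i.2 : ℕ) < j then 2 else 1) else 0

def box (k N : ℕ) : Finset (ℕ × Fin k) := (Finset.Icc 1 N) ×ˢ Finset.univ

lemma mem_box {k N : ℕ} {i : ℕ × Fin k} : i ∈ box k N ↔ 1 ≤ i.1 ∧ i.1 ≤ N := by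
  simp [box]

noncomputable def tgt (k j n N : ℕ) : Finset (Σ _ : (ℕ × Fin k) →₀ ℕ, Finset (ℕ × Fin k)) :=
  (((box k N).finsuppAntidiag n).filter (fun l => ∀ i ∈ box k N, i.1 ∣ l i)).sigma
    (fun l => ((box k N).filter (fun i => l i ≠ 0 ∧ (i.2 : ℕ) < j)).powerset)

lemma coeff_eq_card (k j n N : ℕ) :
    PowerSeries.coeff n (∏ i ∈ box k N, loc k j i) = (tgt k j n N).card := by
  classical
  rw [PowerSeries.coeff_prod, tgt, Finset.card_sigma, Finset.sum_filter]
  refine Finset.sum_congr rfl fun l hl => ?_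
  split_ifs with h
  · rw [Finset.card_powerset, Finset.card_filter, ← Finset.prod_pow_eq_pow_sum]
    refine Finset.prod_congr rfl fun i hi => ?_
    simp only [loc, PowerSeries.coeff_mk, if_pos (h i hi)]
    split_ifs <;> simp
  · push Not at h
    obtain ⟨i, hi, hd⟩ := h
    refine Finset.prod_eq_zero hi ?_
    simp [loc, hd]

noncomputable def fwd {k j n : ℕ} (x : ColouredOverpartition k j n) :
    Σ _ : (ℕ × Fin k) →₀ ℕ, Finset (ℕ × Fin k) :=
  ⟨Finsupp.onFinset x.parts.toFinset (fun i => i.1 * x.parts.count i) (by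
    intro i hi
    by_contra h
    apply hi
    simp only [Multiset.mem_toFinset] at h
    simp [Multiset.count_eq_zero_of_notMem h]), x.overlined⟩

lemma parts_sub_box {k j n N : ℕ} (hN : n ≤ N) (x : ColouredOverpartition k j n) :
    x.parts.toFinset ⊆ box k N := by
  intro i hi
  rw [Multiset.mem_toFinset] at hi
  rw [mem_box]
  refine ⟨x.parts_pos i hi, le_trans ?_ hN⟩
  have := Multiset.le_sum_of_mem (Multiset.mem_map_of_mem Prod.fst hi)
  rwa [x.parts_sum] at this

lemma fwd_mem {k j n N : ℕ} (hN : n ≤ N) (x : ColouredOverpartition k j n) :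
    fwd x ∈ tgt k j n N := by
  classical
  have hsub := parts_sub_box hN x
  simp only [tgt, fwd, Finset.mem_sigma, Finset.mem_filter, Finset.mem_finsuppAntidiag,
    Finset.mem_powerset, Finsupp.onFinset_apply]
  refine ⟨⟨⟨?_, ?_⟩, fun i _ => Dvd.intro _ rfl⟩, ?_⟩
  · have h := Finset.sum_multiset_map_count x.parts Prod.fst
    refine Eq.trans ?_ x.parts_sum
    rw [h]
    symm
    rw [Finset.sum_subset hsub]
    · exact Finset.sum_congr rfl fun i _ => by simp [mul_comm]
    · intro i _ hi
      simp only [Multiset.mem_toFinset] at hi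
      simp [Multiset.count_eq_zero_of_notMem hi]
  · exact (Finsupp.support_onFinset_subset).trans hsub
  · intro i hi
    obtain ⟨h1, h2⟩ := x.overlined_mem i hi
    refine Finset.mem_filter.2 ⟨hsub (Multiset.mem_toFinset.2 h1), ?_, h2⟩
    change i.1 * x.parts.count i ≠ 0
    have := x.parts_pos i h1
    have := Multiset.count_pos.2 h1
    positivity

lemma fwd_inj {k j n : ℕ} : Function.Injective (fwd (k := k) (j := j) (n := n)) := by
  classical
  intro x y h
  simp only [fwd, Sigma.mk.injEq, heq_eq_eq] at h
  obtain ⟨h1, h2⟩ := h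
  have h3 : x.parts = y.parts := by
    ext i
    have := DFunLike.congr_fun h1 i
    simp only [Finsupp.onFinset_apply] at this
    by_cases h0 : i.1 = 0
    · rw [Multiset.count_eq_zero_of_notMem, Multiset.count_eq_zero_of_notMem]
      · intro h; have := y.parts_pos i h; omega
      · intro h; have := x.parts_pos i h; omega
    · exact Nat.eq_of_mul_eq_mul_left (Nat.pos_of_ne_zero h0) this
  cases x; cases y; simp_all

lemma fwd_surj {k j n N : ℕ} (y) (hy : y ∈ tgt k j n N) :
    ∃ x : ColouredOverpartition k j n, fwd x = y := by
  classical
  obtain ⟨l, o⟩ := y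
  simp only [tgt, Finset.mem_sigma, Finset.mem_filter, Finset.mem_finsuppAntidiag,
    Finset.mem_powerset] at hy
  obtain ⟨⟨⟨hsum, hsupp⟩, hdvd⟩, ho⟩ := hy
  have hl0 : ∀ i, i ∉ box k N → l i = 0 := fun i hi => by
    by_contra h; exact hi (hsupp (Finsupp.mem_support_iff.2 h))
  have hdvd' : ∀ i, i.1 ∣ l i := fun i => by
    by_cases h : i ∈ box k N
    · exact hdvd i h
    · rw [hl0 i h]; exact dvd_zero _
  let m : Multiset (ℕ × Fin k) := ∑ i ∈ box k N, Multiset.replicate (l i / i.1) i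
  have hcount : ∀ i, m.count i = l i / i.1 := by
    intro i
    simp only [m, Multiset.count_sum', Multiset.count_replicate]
    rw [Finset.sum_ite_eq']
    split_ifs with h
    · rfl
    · rw [hl0 i h]; simp
  have hmem : ∀ i, i ∈ m → i ∈ box k N := by
    intro i hi
    by_contra h
    have := Multiset.count_pos.2 hi
    rw [hcount, hl0 i h] at this
    simp at this
  have key : ∀ i, i.1 * m.count i = l i := fun i => by
    rw [hcount]; exact Nat.mul_div_cancel' (hdvd' i)
  refine ⟨⟨m, fun p hp => (mem_box.1 (hmem p hp)).1, o, ?_, ?_⟩, ?_⟩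
  · intro p hp
    have := Finset.mem_filter.1 (ho hp)
    refine ⟨?_, this.2.2⟩
    rw [← Multiset.count_pos]
    have h1 := key p
    by_contra h
    have h0 : m.count p = 0 := by omega
    rw [h0] at h1
    exact this.2.1 (by simpa using h1.symm)
  · rw [Finset.sum_multiset_map_count, Finset.sum_subset (s₂ := box k N)]
    · rw [← hsum]
      refine Finset.sum_congr rfl fun i _ => ?_
      rw [← key i, smul_eq_mul, mul_comm]
    · intro i hi; exact hmem i (Multiset.mem_toFinset.1 hi)
    · intro i _ hi
      simp only [Multiset.mem_toFinset] at hi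
      simp [Multiset.count_eq_zero_of_notMem hi]
  · simp only [fwd, Sigma.mk.injEq, heq_eq_eq, and_true]
    ext i
    simpa using key i

lemma card_eq {k j n N : ℕ} (hN : n ≤ N) :
    Nat.card (ColouredOverpartition k j n) =
      PowerSeries.coeff n (∏ i ∈ box k N, loc k j i) := by
  rw [coeff_eq_card]
  rw [← Nat.card_eq_finsetCard]
  refine Nat.card_eq_of_bijective (fun x => ⟨fwd x, fwd_mem hN x⟩) ⟨?_, ?_⟩
  · intro x y h
    exact fwd_inj (by simpa using h)
  · rintro ⟨y, hy⟩
    obtain ⟨x, hx⟩ := fwd_surj y hy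
    exact ⟨x, by simpa using hx⟩

end CO


namespace CO
open Finset Filter Topology

noncomputable def EE (q : ℂ) : ℂ := ∏' n : ℕ, (1 - q ^ (n + 1))
noncomputable def BB (q : ℂ) : ℂ := ∏' n : ℕ, (1 + q ^ (n + 1))
noncomputable def FF (k j : ℕ) (q : ℂ) : ℂ := BB q ^ j / EE q ^ k

noncomputable def cnt (k j n : ℕ) : ℕ := Nat.card (ColouredOverpartition k j n)

lemma mult_sub {q : ℂ} (hq : ‖q‖ < 1) : Multipliable fun n : ℕ ↦ 1 - q ^ (n + 1) :=
  ModularForm.multipliable_one_sub_pow hq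

lemma mult_add {q : ℂ} (hq : ‖q‖ < 1) : Multipliable fun n : ℕ ↦ 1 + q ^ (n + 1) := by
  apply multipliable_one_add_of_summable (f := fun n ↦ q ^ (n + 1))
  simpa using (summable_nat_add_iff 1).mpr (summable_geometric_of_lt_one (norm_nonneg _) hq)

lemma pow_ne_one' {q : ℂ} (hq : ‖q‖ < 1) {m : ℕ} (hm : m ≠ 0) : 1 - q ^ m ≠ 0 := by
  intro h
  have h1 : q ^ m = 1 := (sub_eq_zero.1 h).symm
  have h2 : ‖q‖ ^ m < 1 := pow_lt_one₀ (norm_nonneg _) hq hm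
  rw [← norm_pow, h1] at h2
  simp at h2

lemma EE_ne_zero {q : ℂ} (hq : ‖q‖ < 1) : EE q ≠ 0 := by
  unfold EE
  have := tprod_one_add_ne_zero_of_summable (f := fun n : ℕ ↦ -q ^ (n + 1)) ?_ ?_
  · simpa [sub_eq_add_neg] using this
  · intro i
    simpa [sub_eq_add_neg] using pow_ne_one' hq (Nat.succ_ne_zero i)
  · simpa using (summable_nat_add_iff 1).mpr (summable_geometric_of_lt_one (norm_nonneg _) hq)

/-- coefficient -/
noncomputable abbrev cf (n : ℕ) (f : PowerSeries ℕ) : ℕ := PowerSeries.coeff n f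

/-- power series evaluation -/
def Ev (f : PowerSeries ℕ) (q v : ℂ) : Prop :=
  Summable (fun n => ‖(cf n f : ℂ) * q ^ n‖) ∧
    HasSum (fun n => (cf n f : ℂ) * q ^ n) v

lemma Ev.mul {f g : PowerSeries ℕ} {q v w : ℂ} (hf : Ev f q v) (hg : Ev g q w) :
    Ev (f * g) q (v * w) := by
  have key : ∀ n, ((cf n (f * g) : ℕ) : ℂ) * q ^ n =
      ∑ kl ∈ Finset.HasAntidiagonal.antidiagonal n,
        ((cf kl.1 f : ℂ) * q ^ kl.1) * ((cf kl.2 g : ℂ) * q ^ kl.2) := by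
    intro n
    rw [cf, PowerSeries.coeff_mul]
    push_cast
    rw [Finset.sum_mul]
    refine Finset.sum_congr rfl fun x hx => ?_
    rw [← Finset.HasAntidiagonal.mem_antidiagonal.1 hx, pow_add]
    ring
  have h1 := summable_norm_sum_mul_antidiagonal_of_summable_norm hf.1 hg.1
  have h2 := tsum_mul_tsum_eq_tsum_sum_antidiagonal_of_summable_norm hf.1 hg.1
  rw [hf.2.tsum_eq, hg.2.tsum_eq] at h2
  refine ⟨by simpa only [key] using h1, ?_⟩
  simp only [key]
  rw [h2]
  exact (Summable.of_norm h1).hasSum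

lemma Ev.one (q : ℂ) : Ev 1 q 1 := by
  have : ∀ n, n ≠ 0 → ((cf n (1 : PowerSeries ℕ) : ℕ) : ℂ) * q ^ n = 0 := by
    intro n hn
    simp [PowerSeries.coeff_one, hn]
  constructor
  · apply summable_of_ne_finset_zero (s := {0})
    intro n hn
    rw [this n (by simpa using hn), norm_zero]
  · convert! hasSum_single 0 this using 1
    simp

lemma Ev.prod {ι : Type*} (s : Finset ι) (f : ι → PowerSeries ℕ) (q : ℂ) (v : ι → ℂ)
    (h : ∀ i ∈ s, Ev (f i) q (v i)) : Ev (∏ i ∈ s, f i) q (∏ i ∈ s, v i) := by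
  classical
  induction s using Finset.induction_on with
  | empty => simpa using Ev.one q
  | insert a s ha ih =>
    rw [Finset.prod_insert ha, Finset.prod_insert ha]
    exact (h a (by simp)).mul (ih fun i hi => h i (by simp [hi]))

noncomputable def locv {k : ℕ} (j : ℕ) (q : ℂ) (i : ℕ × Fin k) : ℂ :=
  (if (i.2 : ℕ) < j then 1 + q ^ i.1 else 1) / (1 - q ^ i.1)

lemma Ev_loc {k j : ℕ} {q : ℂ} (hq : ‖q‖ < 1) (i : ℕ × Fin k) (hi : 1 ≤ i.1) :
    Ev (loc k j i) q (locv j q i) := by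
  have hqm : ‖q ^ i.1‖ < 1 := by
    rw [norm_pow]; exact pow_lt_one₀ (norm_nonneg _) hq (by omega)
  have hne := pow_ne_one' hq (m := i.1) (by omega)
  have hinj : Function.Injective (fun c : ℕ => i.1 * c) := fun a b h =>
    Nat.eq_of_mul_eq_mul_left (by omega) h
  have hout : ∀ x ∉ Set.range (fun c : ℕ => i.1 * c),
      ((cf x (loc k j i) : ℕ) : ℂ) * q ^ x = 0 := by
    intro x hx
    have : ¬ i.1 ∣ x := by rintro ⟨c, rfl⟩; exact hx ⟨c, rfl⟩
    simp [loc, this]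
  have hs : HasSum (fun c : ℕ => (2 : ℂ) * (q ^ i.1) ^ c - (if c = 0 then 1 else 0))
      ((1 + q ^ i.1) / (1 - q ^ i.1)) := by
    have h1 := ((hasSum_geometric_of_norm_lt_one hqm).mul_left 2).sub (hasSum_ite_eq (0 : ℕ) (1 : ℂ))
    convert! h1 using 1
    field_simp
    ring
  have main : HasSum (fun n => ((cf n (loc k j i) : ℕ) : ℂ) * q ^ n) (locv j q i) := by
    rw [← hinj.hasSum_iff hout]
    by_cases hj : (i.2 : ℕ) < j
    · have : locv j q i = ((1 + q ^ i.1) / (1 - q ^ i.1)) := by simp [locv, hj]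
      rw [this]
      convert! hs using 1
      ext c
      by_cases hc : c = 0
      · simp [loc, hc]; norm_num
      · have : i.1 ≠ 0 := by omega
        simp [loc, hc, hj, this, pow_mul]
    · have : locv j q i = (1 - q ^ i.1)⁻¹ := by simp [locv, hj]
      rw [this]
      convert! (hasSum_geometric_of_norm_lt_one hqm) using 1
      ext c
      simp [loc, hj, pow_mul]
  exact ⟨main.summable.norm, main⟩

lemma prod_box (k j N : ℕ) (hjk : j ≤ k) (q : ℂ) :
    ∏ i ∈ box k N, locv j q i =
      (∏ n ∈ range N, (1 + q ^ (n + 1))) ^ j / (∏ n ∈ range N, (1 - q ^ (n + 1))) ^ k := by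
  rw [box, Finset.prod_product]
  have h : ∀ m : ℕ, ∏ c : Fin k, locv j q (m, c) = (1 + q ^ m) ^ j / (1 - q ^ m) ^ k := by
    intro m
    simp only [locv]
    rw [Finset.prod_div_distrib]
    simp only [Finset.prod_const, Finset.card_univ, Fintype.card_fin]
    congr 1
    rw [Finset.prod_ite]
    simp only [Finset.prod_const, one_pow, mul_one]
    congr 1
    rw [Fin.card_filter_val_lt]
    simp [hjk]
  simp only [h]
  rw [← Finset.prod_pow, ← Finset.prod_pow, ← Finset.prod_div_distrib]
  rw [Finset.range_eq_Ico, Finset.prod_Ico_add' (fun m => (1 + q ^ m) ^ j / (1 - q ^ m) ^ k) 0 N 1]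
  rfl

lemma tendsto_box (k j : ℕ) (hjk : j ≤ k) {q : ℂ} (hq : ‖q‖ < 1) :
    Tendsto (fun N => ∏ i ∈ box k N, locv j q i) atTop (𝓝 (FF k j q)) := by
  simp only [prod_box k j _ hjk]
  exact ((mult_add hq).tendsto_prod_tprod_nat.pow j).div
    ((mult_sub hq).tendsto_prod_tprod_nat.pow k) (pow_ne_zero _ (EE_ne_zero hq))

lemma coeff_le (k j n N : ℕ) :
    cf n (∏ i ∈ box k N, loc k j i) ≤ cnt k j n := by
  rw [cnt, card_eq (le_max_left n N)]
  have hsub : box k N ⊆ box k (max n N) := by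
    intro i hi
    rw [mem_box] at hi ⊢
    exact ⟨hi.1, hi.2.trans (le_max_right _ _)⟩
  rw [← Finset.prod_sdiff hsub, PowerSeries.coeff_mul]
  have h0 : cf 0 (∏ i ∈ box k (max n N) \ box k N, loc k j i) = 1 := by
    rw [cf, PowerSeries.coeff_zero_eq_constantCoeff, map_prod]
    refine Finset.prod_eq_one fun i _ => ?_
    rw [← PowerSeries.coeff_zero_eq_constantCoeff_apply]
    simp [loc]
  have := Finset.single_le_sum (f := fun p : ℕ × ℕ =>
    cf p.1 (∏ i ∈ box k (max n N) \ box k N, loc k j i) *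
      cf p.2 (∏ i ∈ box k N, loc k j i)) (fun _ _ => Nat.zero_le _)
      (show (0, n) ∈ Finset.HasAntidiagonal.antidiagonal n by simp)
  simpa [h0] using this

lemma gen_fun (k j : ℕ) (hjk : j ≤ k) {q : ℂ} (hq : ‖q‖ < 1) :
    Summable (fun n => ‖(cnt k j n : ℂ) * q ^ n‖) ∧
    HasSum (fun n => (cnt k j n : ℂ) * q ^ n) (FF k j q) := by
  have hEv : ∀ {q : ℂ}, ‖q‖ < 1 → ∀ N, Ev (∏ i ∈ box k N, loc k j i) q (∏ i ∈ box k N, locv j q i) :=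
    fun hq N => Ev.prod _ _ _ _ fun i hi => Ev_loc hq i (mem_box.1 hi).1
  -- summability
  have hr : ‖((‖q‖ : ℝ) : ℂ)‖ < 1 := by simpa using hq
  have hlim := (tendsto_box k j hjk hr).norm
  obtain ⟨C, hC⟩ := hlim.bddAbove_range
  have hsumm : Summable (fun n => (cnt k j n : ℝ) * ‖q‖ ^ n) := by
    apply summable_of_sum_range_le (c := C) (fun n => by positivity)
    intro N
    refine le_trans ?_ (hC ⟨N, rfl⟩)
    have h1 := (hEv hr N)
    have h2 : HasSum (fun n => (cf n (∏ i ∈ box k N, loc k j i) : ℝ) * ‖q‖ ^ n)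
        (∏ i ∈ box k N, locv j ((‖q‖ : ℝ) : ℂ) i).re := by
      have := Complex.hasSum_re h1.2
      convert! this using 1
      ext n
      have : ((cf n (∏ i ∈ box k N, loc k j i) : ℕ) : ℂ) * ((‖q‖ : ℝ) : ℂ) ^ n
        = (((cf n (∏ i ∈ box k N, loc k j i) : ℝ) * ‖q‖ ^ n : ℝ) : ℂ) := by
        push_cast; rfl
      rw [this, Complex.ofReal_re]
    refine le_trans ?_ (Complex.re_le_norm _)
    refine le_trans (le_of_eq ?_) (sum_le_hasSum (range N) (fun _ _ => by positivity) h2)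
    refine Finset.sum_congr rfl fun n hn => ?_
    rw [cnt, card_eq (Finset.mem_range.1 hn).le]
  have hsumm' : Summable (fun n => ‖(cnt k j n : ℂ) * q ^ n‖) := by
    simpa using hsumm
  refine ⟨hsumm', ?_⟩
  have hT : Tendsto (fun N => ∑' n, (cf n (∏ i ∈ box k N, loc k j i) : ℂ) * q ^ n)
      atTop (𝓝 (∑' n, (cnt k j n : ℂ) * q ^ n)) := by
    refine tendsto_tsum_of_dominated_convergence hsumm ?_ ?_
    · intro n
      refine tendsto_const_nhds.congr' ?_
      filter_upwards [eventually_ge_atTop n] with N hN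
      rw [cnt, card_eq hN]
    · refine Eventually.of_forall fun N n => ?_
      rw [norm_mul, norm_pow, Complex.norm_natCast]
      gcongr
      exact coeff_le k j n N
  have hT2 : Tendsto (fun N => ∏ i ∈ box k N, locv j q i) atTop (𝓝 (∑' n, (cnt k j n : ℂ) * q ^ n)) := by
    refine hT.congr fun N => ?_
    exact (hEv hq N).2.tsum_eq
  rw [tendsto_nhds_unique (tendsto_box k j hjk hq) hT2]
  exact hsumm'.of_norm.hasSum

end CO


namespace CO
open Finset Filter Topology Complex
open scoped Real

lemma eta_val (t : ℂ) : ModularForm.eta (I * t / (2 * π)) = cexp (-t / 24) * EE (cexp (-t)) := by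
  have hpi : (π : ℂ) ≠ 0 := by exact_mod_cast Real.pi_ne_zero
  have h : 2 * π * I * (I * t / (2 * π)) = -t := by
    field_simp
    rw [I_sq]; ring
  unfold ModularForm.eta EE
  congr 1
  · simp only [Function.Periodic.qParam]
    congr 1
    rw [h]; simp
  · refine tprod_congr fun n => ?_
    rw [ModularForm.eta_q_eq_pow, h]

lemma sqrt_fac {t : ℂ} (ht : 0 < t.re) :
    (sqrt I)⁻¹ * sqrt (I * t / (2 * π)) = cexp (1 / 2 * log (t / (2 * π))) := by
  have hpi : (π : ℂ) ≠ 0 := by exact_mod_cast Real.pi_ne_zero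
  have hu : 0 < (t / (2 * π)).re := by
    have : t / (2 * π) = t / ((2 * π : ℝ) : ℂ) := by push_cast; rfl
    rw [this, Complex.div_ofReal_re]
    have := Real.pi_pos
    positivity
  have e : I * t / (2 * π) = I * (t / (2 * π)) := by ring
  rw [e]
  set u := t / (2 * π) with hu'
  have hu0 : u ≠ 0 := by intro h; rw [h] at hu; simp at hu
  have ha := Complex.abs_arg_lt_pi_div_two_iff.2 (Or.inl hu)
  rw [abs_lt] at ha
  have hl : log (I * u) = log I + log u := by
    apply Complex.log_mul I_ne_zero hu0
    rw [arg_I]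
    constructor <;> linarith [Real.pi_pos]
  rw [sqrt, sqrt, cpow_def_of_ne_zero I_ne_zero, cpow_def_of_ne_zero (mul_ne_zero I_ne_zero hu0), hl,
    ← Complex.exp_neg, ← Complex.exp_add]
  congr 1
  ring

lemma norm_exp_neg_lt {t : ℂ} (ht : 0 < t.re) : ‖cexp (-t)‖ < 1 := by
  rw [Complex.norm_exp]
  simpa using ht

lemma re_const_div {t : ℂ} (ht : 0 < t.re) {c : ℝ} (hc : 0 < c) : 0 < ((c : ℂ) / t).re := by
  have h0 : t ≠ 0 := by intro h; rw [h] at ht; simp at ht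
  rw [Complex.div_re]
  simp only [ofReal_re, ofReal_im, zero_mul, zero_div, add_zero]
  have := Complex.normSq_pos.2 h0
  positivity

lemma EE_transf {t : ℂ} (ht : 0 < t.re) :
    (EE (cexp (-t)))⁻¹ = cexp (1 / 2 * log (t / (2 * π)) + π ^ 2 / (6 * t) - t / 24) *
      (EE (cexp (-((4 * π ^ 2 : ℝ) / t))))⁻¹ := by
  have hpi : (π : ℂ) ≠ 0 := by exact_mod_cast Real.pi_ne_zero
  have h0 : t ≠ 0 := by intro h; rw [h] at ht; simp at ht
  have hmem : I * t / (2 * π) ∈ UpperHalfPlane.upperHalfPlaneSet := by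
    change 0 < (I * t / (2 * π)).im
    have : I * t / (2 * π) = I * t / ((2 * π : ℝ) : ℂ) := by push_cast; rfl
    rw [this, Complex.div_ofReal_im]
    have := Real.pi_pos
    simp only [I_mul_im]
    positivity
  have h := ModularForm.eta_comp_eq_csqrt_I_inv hmem
  simp only [Function.comp, Pi.smul_apply, Pi.mul_apply, smul_eq_mul] at h
  have e : -1 / (I * t / (2 * π)) = I * ((4 * π ^ 2 : ℝ) / t) / (2 * π) := by
    push_cast
    field_simp
    rw [I_sq]; ring
  rw [e, eta_val, eta_val, ← mul_assoc, sqrt_fac ht] at h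
  have hE1 := EE_ne_zero (norm_exp_neg_lt ht)
  have hE2 := EE_ne_zero (norm_exp_neg_lt (re_const_div ht (c := 4 * π ^ 2) (by positivity)))
  set E1 := EE (cexp (-t))
  set E2 := EE (cexp (-((4 * π ^ 2 : ℝ) / t)))
  have e2 : cexp (1 / 2 * log (t / (2 * π)) + π ^ 2 / (6 * t) - t / 24) =
      cexp (1 / 2 * log (t / (2 * π))) * cexp (-t / 24) *
        (cexp (-((4 * π ^ 2 : ℝ) / t) / 24))⁻¹ := by
    rw [← Complex.exp_neg, ← Complex.exp_add, ← Complex.exp_add]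
    congr 1
    push_cast
    field_simp
    ring
  rw [e2]
  have hx := Complex.exp_ne_zero (-((4 * π ^ 2 : ℝ) / t) / 24)
  generalize cexp (-((4 * π ^ 2 : ℝ) / t) / 24) = a at *
  generalize cexp (1 / 2 * log (t / (2 * π))) = b at *
  generalize cexp (-t / 24) = c at *
  field_simp
  linear_combination h

lemma BB_mul_EE {q : ℂ} (hq : ‖q‖ < 1) : BB q * EE q = EE (q ^ 2) := by
  unfold BB EE
  rw [← (mult_add hq).tprod_mul (mult_sub hq)]
  refine tprod_congr fun n => ?_
  ring

lemma FF_eq {q : ℂ} (hq : ‖q‖ < 1) (k j : ℕ) :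
    FF k j q = (EE q)⁻¹ ^ (k + j) * ((EE (q ^ 2))⁻¹ ^ j)⁻¹ := by
  have h0 := EE_ne_zero hq
  have h1 : ‖q ^ 2‖ < 1 := by rw [norm_pow]; exact pow_lt_one₀ (norm_nonneg _) hq (by norm_num)
  have h2 := EE_ne_zero h1
  unfold FF
  rw [← BB_mul_EE hq] at h2 ⊢
  have h3 : BB q ≠ 0 := left_ne_zero_of_mul h2
  simp only [inv_pow, inv_inv, mul_pow, pow_add]
  field_simp

noncomputable def RR (k j : ℕ) (w : ℂ) : ℂ := EE w ^ j * ((EE (w ^ 2)) ^ (k + j))⁻¹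

lemma FF_exp {t : ℂ} (ht : 0 < t.re) (k j : ℕ) :
    FF k j (cexp (-t)) = cexp (k / 2 * log (t / (2 * π)) - j / 2 * Real.log 2 +
      (π ^ 2 * (2 * k + j) / 12) / t + (j - k) / 24 * t) * RR k j (cexp (-((2 * π ^ 2 : ℝ) / t))) := by
  have hpi : (π : ℂ) ≠ 0 := by exact_mod_cast Real.pi_ne_zero
  have h0 : t ≠ 0 := by intro h; rw [h] at ht; simp at ht
  have ht2 : 0 < (2 * t).re := by simpa using ht
  rw [FF_eq (norm_exp_neg_lt ht), ← Complex.exp_nat_mul]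
  have e1 : ((2 : ℕ) : ℂ) * -t = -(2 * t) := by push_cast; ring
  rw [e1, EE_transf ht, EE_transf ht2]
  have e2 : cexp (-((4 * π ^ 2 : ℝ) / (2 * t))) = cexp (-((2 * π ^ 2 : ℝ) / t)) := by
    congr 1; push_cast; field_simp; norm_num
  have e3 : cexp (-((4 * π ^ 2 : ℝ) / t)) = cexp (-((2 * π ^ 2 : ℝ) / t)) ^ 2 := by
    rw [← Complex.exp_nat_mul]
    congr 1; push_cast; ring
  have e4 : log (2 * t / (2 * π)) = Real.log 2 + log (t / (2 * π)) := by
    have : 2 * t / (2 * π) = ((2 : ℝ) : ℂ) * (t / (2 * π)) := by push_cast; ring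
    rw [this, Complex.log_ofReal_mul (by norm_num)]
    exact div_ne_zero h0 (by simpa using hpi)
  rw [e2, e3, e4]
  unfold RR
  simp only [mul_pow, mul_inv, inv_pow, inv_inv, ← Complex.exp_nat_mul]
  rw [← Complex.exp_neg]
  have : ∀ a b c d e : ℂ, (a * b) * (c * d) = (a * c) * (d * b) := by intros; ring
  rw [this _ _ _ _ 0, ← Complex.exp_add]
  congr 2
  push_cast
  field_simp
  ring

lemma RR_bound (k j : ℕ) : ∃ C > 0, ∃ ε > 0, ∀ w : ℂ, ‖w‖ < ε → ‖RR k j w - 1‖ ≤ C * ‖w‖ := by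
  have hd := ModularForm.differentiableOn_tprod_one_sub_pow
  have hE0 : EE 0 = 1 := by simp [EE]
  have hE : DifferentiableAt ℂ EE 0 :=
    hd.differentiableAt (Metric.isOpen_ball.mem_nhds (by simp))
  have hE' : DifferentiableAt ℂ EE ((fun w : ℂ => w ^ 2) 0) := by simpa using hE
  have hE2 : DifferentiableAt ℂ (fun w : ℂ => EE (w ^ 2)) 0 :=
    DifferentiableAt.comp (g := EE) (f := fun w : ℂ => w ^ 2) 0 hE' (by fun_prop)
  have hR : DifferentiableAt ℂ (RR k j) 0 := by
    unfold RR
    refine (hE.pow j).mul ((hE2.pow (k + j)).inv ?_)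
    simp [hE0]
  have hO := hR.hasDerivAt.isBigO_sub
  obtain ⟨C, hC, hb⟩ := hO.exists_pos
  rw [Asymptotics.IsBigOWith, Metric.eventually_nhds_iff] at hb
  obtain ⟨ε, hε, hb⟩ := hb
  refine ⟨C, hC, ε, hε, fun w hw => ?_⟩
  have := hb (y := w) (by simpa using hw)
  simpa [RR, hE0] using this

end CO


namespace CO
open Finset Filter Topology Complex
open scoped Real

noncomputable def AA (k j : ℕ) : ℝ := π ^ 2 * (2 * k + j) / 12
noncomputable def M0 (k j : ℕ) (t : ℝ) : ℝ := Real.exp (k / 2 * Real.log (t / (2 * π)) - j / 2 * Real.log 2)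

lemma norm_w_le {t0 y : ℝ} (h0 : 0 < t0) (hy : |y| ≤ 1 / 2) :
    ‖cexp (-((2 * π ^ 2 : ℝ) / (t0 * (1 + y * I))))‖ ≤ t0 := by
  have hy2 : y ^ 2 ≤ 1 / 4 := by
    rw [← sq_abs]; nlinarith [abs_nonneg y]
  have hns : normSq (t0 * (1 + y * I) : ℂ) = t0 ^ 2 * (1 + y ^ 2) := by
    simp [normSq_apply]; ring
  have hre : (((2 * π ^ 2 : ℝ) : ℂ) / (t0 * (1 + y * I))).re = 2 * π ^ 2 / (t0 * (1 + y ^ 2)) := by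
    rw [Complex.div_re, hns, ofReal_re, ofReal_im]
    simp
    field_simp
  rw [Complex.norm_exp, neg_re, hre]
  have hpi : 3 < π := Real.pi_gt_three
  have h1 : 1 / t0 ≤ 2 * π ^ 2 / (t0 * (1 + y ^ 2)) := by
    rw [div_le_div_iff₀ h0 (by positivity)]
    have h5 : (1 + y ^ 2) ≤ 2 * π ^ 2 := by nlinarith
    nlinarith
  have h2 : Real.exp (-(2 * π ^ 2 / (t0 * (1 + y ^ 2)))) ≤ Real.exp (-(1 / t0)) :=
    Real.exp_le_exp.2 (by linarith)
  refine h2.trans ?_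
  rw [Real.exp_neg]
  have h3 := Real.add_one_le_exp (1 / t0)
  have h4 : 1 / t0 ≤ Real.exp (1 / t0) := by linarith
  calc (Real.exp (1 / t0))⁻¹ ≤ (1 / t0)⁻¹ := inv_anti₀ (by positivity) h4
    _ = t0 := by simp

lemma FF_cone (k j : ℕ) : ∃ K > 0, ∃ τ > 0, ∀ t0 : ℝ, 0 < t0 → t0 < τ → ∀ y : ℝ, |y| ≤ 1 / 2 →
    ∃ R : ℂ, ‖R - 1‖ ≤ K * t0 ∧ FF k j (cexp (-(t0 * (1 + y * I)))) =
      M0 k j t0 * cexp (k / 2 * log (1 + y * I) + (AA k j / t0 : ℝ) / (1 + y * I)) * R := by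
  obtain ⟨C, hC, ε, hε, hR⟩ := RR_bound k j
  set D : ℝ := ‖((j - k) / 24 : ℂ)‖ * 2 with hD
  have hD0 : 0 ≤ D := by positivity
  refine ⟨2 * D * C + 2 * D + C, by positivity, min ε (min 1 (1 / (D + 1))), by positivity, ?_⟩
  intro t0 h0 hτ y hy
  have hτ1 : t0 < ε := hτ.trans_le (min_le_left _ _)
  have hτ2 : t0 < 1 := hτ.trans_le ((min_le_right _ _).trans (min_le_left _ _))
  have hτ3 : t0 < 1 / (D + 1) := hτ.trans_le ((min_le_right _ _).trans (min_le_right _ _))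
  set t : ℂ := t0 * (1 + y * I) with ht
  have htre : 0 < t.re := by simp [ht, h0]
  have hw := norm_w_le h0 hy
  rw [← ht] at hw
  set w := cexp (-((2 * π ^ 2 : ℝ) / t)) with hwdef
  have htn : ‖t‖ ≤ 2 * t0 := by
    rw [ht, norm_mul, Complex.norm_of_nonneg h0.le]
    have : ‖(1 + y * I : ℂ)‖ ≤ 1 + |y| := by
      refine (norm_add_le _ _).trans ?_
      simp
    nlinarith
  have hu : ‖((j - k) / 24 * t : ℂ)‖ ≤ D * t0 := by
    rw [norm_mul, hD]
    nlinarith [norm_nonneg ((j - k) / 24 : ℂ)]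
  have hDt : D * t0 ≤ 1 := by
    rw [lt_div_iff₀ (by positivity)] at hτ3
    nlinarith
  have he := Complex.norm_exp_sub_one_le (hu.trans hDt)
  have hr := hR w (hw.trans_lt hτ1)
  refine ⟨cexp ((j - k) / 24 * t) * RR k j w, ?_, ?_⟩
  · set a := cexp ((j - k) / 24 * t)
    set b := RR k j w
    have e : a * b - 1 = (a - 1) * (b - 1) + (a - 1) + (b - 1) := by ring
    have ha : ‖a - 1‖ ≤ 2 * D * t0 := by linarith
    have hb : ‖b - 1‖ ≤ C * t0 := hr.trans (by gcongr)
    rw [e]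
    calc _ ≤ ‖a - 1‖ * ‖b - 1‖ + ‖a - 1‖ + ‖b - 1‖ := by
          refine (norm_add_le _ _).trans ?_
          gcongr
          refine (norm_add_le _ _).trans ?_
          rw [norm_mul]
      _ ≤ (2 * D * t0) * (C * t0) + 2 * D * t0 + C * t0 := by gcongr
      _ ≤ _ := by
        have : (2 * D * t0) * (C * t0) ≤ 2 * D * C * t0 := by
          have : 0 ≤ 2 * D * C * t0 := by positivity
          nlinarith
        linarith
  · rw [FF_exp htre, ← hwdef]
    have hlog : log (t / (2 * π)) = Real.log (t0 / (2 * π)) + log (1 + y * I) := by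
      have e : t / (2 * π) = ((t0 / (2 * π) : ℝ) : ℂ) * (1 + y * I) := by
        rw [ht]; push_cast; ring
      rw [e, Complex.log_ofReal_mul (by positivity)]
      intro h
      have := congrArg Complex.re h
      simp at this
    have ht0 : (t0 : ℂ) ≠ 0 := by exact_mod_cast h0.ne'
    have hy0 : (1 + y * I : ℂ) ≠ 0 := by
      intro h
      have := congrArg Complex.re h
      simp at this
    rw [hlog, M0, Complex.ofReal_exp, ← Complex.exp_add, ← mul_assoc (cexp _) (cexp _) (RR k j w),
      ← Complex.exp_add]
    congr 2
    rw [AA]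
    push_cast
    rw [ht]
    field_simp
    ring

end CO


namespace CO
open Finset Filter Topology Complex
open scoped Real

lemma term_bound {z : ℂ} (hz : ‖z‖ < 1) :
    (1 - ‖z‖) * Real.exp (‖z‖ - z.re) ≤ ‖1 - z‖ := by
  have hr : ‖((‖z‖ : ℝ) : ℂ)‖ < 1 := by simpa using hz
  have h1 := Complex.hasSum_re (Complex.hasSum_taylorSeries_neg_log hz)
  have h2 := Complex.hasSum_re (Complex.hasSum_taylorSeries_neg_log hr)
  have e1 : (-log (1 - z)).re = - Real.log ‖1 - z‖ := by simp [Complex.log_re]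
  have e2 : (-log (1 - ((‖z‖ : ℝ) : ℂ))).re = - Real.log (1 - ‖z‖) := by
    have : (1 - ((‖z‖ : ℝ) : ℂ)) = ((1 - ‖z‖ : ℝ) : ℂ) := by push_cast; rfl
    rw [this, neg_re, Complex.log_re, Complex.norm_of_nonneg (by linarith)]
  rw [e1] at h1
  rw [e2] at h2
  have h3 := h2.sub h1
  have hnn : ∀ n : ℕ, 0 ≤ (((‖z‖ : ℝ) : ℂ) ^ n / n).re - (z ^ n / n).re := by
    intro n
    have e : (((‖z‖ : ℝ) : ℂ) ^ n / n) = ((‖z‖ ^ n / n : ℝ) : ℂ) := by push_cast; rfl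
    rw [e, ofReal_re]
    have := Complex.re_le_norm (z ^ n / n)
    simp only [norm_div, norm_pow, Complex.norm_natCast] at this
    linarith
  have h4 := sum_le_hasSum {1} (fun i _ => hnn i) h3
  simp at h4
  have hz1 : 0 < 1 - ‖z‖ := by linarith
  have hz2 : 0 < ‖1 - z‖ := by
    have := norm_sub_norm_le 1 z
    rw [norm_one] at this
    linarith
  rw [← Real.log_le_log_iff (by positivity) hz2, Real.log_mul hz1.ne' (Real.exp_pos _).ne',
    Real.log_exp]
  linarith

lemma EE_lower {q : ℂ} (hq : ‖q‖ < 1) :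
    ‖EE (‖q‖ : ℝ)‖ * Real.exp (1 / (1 - ‖q‖) - 1 / ‖1 - q‖) ≤ ‖EE q‖ := by
  have hr : ‖((‖q‖ : ℝ) : ℂ)‖ < 1 := by simpa using hq
  have hq1 : 1 - q ≠ 0 := by simpa using pow_ne_one' hq one_ne_zero
  have hr1 : 1 - ‖q‖ ≠ 0 := by linarith
  have g1 : HasSum (fun n : ℕ => ‖q‖ ^ (n + 1)) (1 / (1 - ‖q‖) - 1) := by
    have := (hasSum_geometric_of_lt_one (norm_nonneg q) hq).mul_left ‖q‖
    convert! this using 1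
    · ext n; ring
    · field_simp; ring
  have g2 : HasSum (fun n : ℕ => (q ^ (n + 1)).re) ((1 / (1 - q) - 1).re) := by
    apply Complex.hasSum_re
    have := (hasSum_geometric_of_norm_lt_one hq).mul_left q
    convert! this using 1
    · ext n; ring
    · field_simp; ring
  have g3 := (g1.sub g2).tendsto_sum_nat
  have g4 := (Real.continuous_exp.tendsto _).comp g3
  have L := ((mult_sub hr).tendsto_prod_tprod_nat.norm).mul g4
  have Rr := (mult_sub hq).tendsto_prod_tprod_nat.norm
  have hle := le_of_tendsto_of_tendsto' L Rr (fun N => by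
    simp only [Function.comp]
    rw [norm_prod, norm_prod, Real.exp_sum, ← Finset.prod_mul_distrib]
    refine Finset.prod_le_prod (fun _ _ => by positivity) fun n _ => ?_
    have hz : ‖q ^ (n + 1)‖ < 1 := by
      rw [norm_pow]; exact pow_lt_one₀ (norm_nonneg _) hq (by omega)
    have := term_bound hz
    rw [norm_pow] at this hz
    have e : ‖1 - ((‖q‖ : ℝ) : ℂ) ^ (n + 1)‖ = 1 - ‖q‖ ^ (n + 1) := by
      have : (1 - ((‖q‖ : ℝ) : ℂ) ^ (n + 1)) = ((1 - ‖q‖ ^ (n + 1) : ℝ) : ℂ) := by push_cast; rfl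
      rw [this, Complex.norm_of_nonneg (by linarith)]
    rw [e]
    exact this)
  refine le_trans ?_ hle
  refine mul_le_mul_of_nonneg_left (Real.exp_le_exp.2 ?_) (norm_nonneg _)
  have := Complex.re_le_norm (1 / (1 - q))
  rw [norm_div, norm_one] at this
  rw [sub_re, one_re]
  linarith

lemma BB_upper {q : ℂ} (hq : ‖q‖ < 1) : ‖BB q‖ ≤ ‖BB (‖q‖ : ℝ)‖ := by
  have hr : ‖((‖q‖ : ℝ) : ℂ)‖ < 1 := by simpa using hq
  refine le_of_tendsto_of_tendsto' (mult_add hq).tendsto_prod_tprod_nat.norm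
    (mult_add hr).tendsto_prod_tprod_nat.norm (fun N => ?_)
  rw [norm_prod, norm_prod]
  refine Finset.prod_le_prod (fun _ _ => by positivity) fun n _ => ?_
  have e : ‖1 + ((‖q‖ : ℝ) : ℂ) ^ (n + 1)‖ = 1 + ‖q‖ ^ (n + 1) := by
    have : (1 + ((‖q‖ : ℝ) : ℂ) ^ (n + 1)) = ((1 + ‖q‖ ^ (n + 1) : ℝ) : ℂ) := by push_cast; rfl
    rw [this, Complex.norm_of_nonneg (by positivity)]
  rw [e]
  refine (norm_add_le _ _).trans ?_
  simp

lemma FF_upper {q : ℂ} (hq : ‖q‖ < 1) (k j : ℕ) (hk : 0 < k) (c : ℝ) (hc : 0 ≤ c)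
    (h : c ≤ 1 / (1 - ‖q‖) - 1 / ‖1 - q‖) :
    ‖FF k j q‖ ≤ ‖FF k j (‖q‖ : ℝ)‖ * Real.exp (-c) := by
  have hr : ‖((‖q‖ : ℝ) : ℂ)‖ < 1 := by simpa using hq
  have h0 : 0 < ‖EE (‖q‖ : ℝ)‖ := norm_pos_iff.2 (EE_ne_zero hr)
  have h1 : ‖EE (‖q‖ : ℝ)‖ * Real.exp c ≤ ‖EE q‖ := by
    refine le_trans ?_ (EE_lower hq)
    gcongr
  unfold FF
  rw [norm_div, norm_div, norm_pow, norm_pow, norm_pow, norm_pow]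
  calc ‖BB q‖ ^ j / ‖EE q‖ ^ k ≤ ‖BB (‖q‖ : ℝ)‖ ^ j / (‖EE (‖q‖ : ℝ)‖ * Real.exp c) ^ k := by
        gcongr
        exact BB_upper hq
    _ = ‖BB (‖q‖ : ℝ)‖ ^ j / ‖EE (‖q‖ : ℝ)‖ ^ k * (Real.exp c ^ k)⁻¹ := by
        rw [mul_pow]; field_simp
    _ ≤ _ := by
        rw [Real.exp_neg]
        gcongr
        exact le_self_pow₀ (Real.one_le_exp hc) hk.ne'

lemma gain {t0 θ : ℝ} (h0 : 0 < t0) (h1 : t0 ≤ 1 / 2) (hθ : t0 / 2 ≤ |θ|) (hθ' : |θ| ≤ π) :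
    0.01 / t0 ≤ 1 / (1 - ‖cexp (-(t0 + θ * I))‖) - 1 / ‖1 - cexp (-(t0 + θ * I))‖ := by
  have hn : ‖cexp (-(t0 + θ * I))‖ = Real.exp (-t0) := by simp [Complex.norm_exp]
  rw [hn]
  set r := Real.exp (-t0) with hr
  have hr1 : 1 - t0 ≤ r := by have := Real.add_one_le_exp (-t0); linarith
  have hr2 : r < 1 := by rw [hr]; simpa using h0
  have hr0 : 0 < r := Real.exp_pos _
  have hq : cexp (-(t0 + θ * I)) = (r * Real.cos θ : ℝ) - (r * Real.sin θ : ℝ) * I := by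
    have : -(t0 + θ * I : ℂ) = ((-t0 : ℝ) : ℂ) + ((-θ : ℝ) : ℂ) * I := by push_cast; ring
    rw [this, Complex.exp_add, Complex.exp_mul_I, ← Complex.ofReal_exp, ← hr, ← ofReal_cos,
      ← ofReal_sin, Real.cos_neg, Real.sin_neg]
    push_cast; ring
  have hsq : ‖1 - cexp (-(t0 + θ * I))‖ ^ 2 = (1 - r) ^ 2 + 2 * r * (1 - Real.cos θ) := by
    rw [hq, ← Complex.normSq_eq_norm_sq, normSq_apply]
    simp only [sub_re, one_re, ofReal_re, mul_re, I_re, I_im, ofReal_im, sub_im, one_im, mul_im]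
    nlinarith [Real.sin_sq_add_cos_sq θ]
  have hcos := Real.cos_le_one_sub_mul_cos_sq hθ'
  have hpi : π ^ 2 < 10 := by nlinarith [Real.pi_lt_d2, Real.pi_pos]
  set d := 1 - r with hd
  have hd0 : 0 < d := by linarith
  have hdt : d ≤ t0 := by linarith
  have hθ2 : d ^ 2 / 4 ≤ θ ^ 2 := by
    rw [← sq_abs θ]; nlinarith [abs_nonneg θ]
  have hcc : d ^ 2 / 20 ≤ 1 - Real.cos θ := by
    have h5 : 0.2 ≤ 2 / π ^ 2 := by
      rw [le_div_iff₀ (by positivity)]; linarith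
    nlinarith
  have hlow : (1.02 * d) ^ 2 ≤ ‖1 - cexp (-(t0 + θ * I))‖ ^ 2 := by
    rw [hsq]; nlinarith
  have hlow' : 1.02 * d ≤ ‖1 - cexp (-(t0 + θ * I))‖ :=
    le_of_sq_le_sq hlow (norm_nonneg _)
  have h7 : 1 / ‖1 - cexp (-(t0 + θ * I))‖ ≤ 1 / (1.02 * d) := by
    gcongr
  have h8 : 0.01 / t0 ≤ 0.01 / d := by gcongr
  have h9 : 1 / d - 1 / (1.02 * d) - 0.01 / d ≥ 0 := by
    have : 1 / d - 1 / (1.02 * d) - 0.01 / d = (1 - 1 / 1.02 - 0.01) / d := by field_simp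
    rw [this]
    apply div_nonneg _ hd0.le
    norm_num
  linarith

end CO


namespace CO
open Finset Filter Topology Complex MeasureTheory
open scoped Real

lemma exp_sub_bound (x : ℂ) : ‖cexp x - 1 - x‖ ≤ (Real.exp x.re + 2) * ‖x‖ ^ 2 := by
  by_cases h : ‖x‖ ≤ 1
  · refine (Complex.norm_exp_sub_one_sub_id_le h).trans ?_
    nlinarith [Real.exp_pos x.re, sq_nonneg ‖x‖]
  · push Not at h
    have h1 : ‖cexp x - 1 - x‖ ≤ Real.exp x.re + 1 + ‖x‖ := by
      refine (norm_sub_le _ _).trans ?_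
      gcongr
      refine (norm_sub_le _ _).trans ?_
      rw [Complex.norm_exp, norm_one]
    have h2 : 1 ≤ ‖x‖ ^ 2 := by nlinarith
    have h3 : ‖x‖ ≤ ‖x‖ ^ 2 := by nlinarith
    have := mul_le_mul_of_nonneg_left h2 (Real.exp_pos x.re).le
    nlinarith

lemma log_bound {y : ℝ} (hy : |y| ≤ 1 / 2) :
    ‖log (1 + y * I) - y * I‖ ≤ y ^ 2 := by
  have hn : ‖(y * I : ℂ)‖ = |y| := by simp
  have := Complex.norm_log_one_add_sub_self_le (z := y * I) (by rw [hn]; linarith)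
  rw [hn] at this
  refine this.trans ?_
  have h1 : (1 - |y|)⁻¹ ≤ 2 := by
    rw [inv_le_comm₀ (by linarith) (by norm_num)]; linarith
  rw [sq_abs]
  nlinarith [sq_nonneg y]

lemma poly_bound {s : ℝ} (hs : 0 ≤ s) :
    s ≤ 2 * Real.exp (s / 2) ∧ s ^ 2 ≤ 8 * Real.exp (s / 2) ∧ s ^ 3 ≤ 48 * Real.exp (s / 2) ∧
      1 ≤ Real.exp (s / 2) := by
  have h0 : 0 ≤ s / 2 := by linarith
  have h1 := Real.pow_div_factorial_le_exp (s / 2) h0 1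
  have h2 := Real.pow_div_factorial_le_exp (s / 2) h0 2
  have h3 := Real.pow_div_factorial_le_exp (s / 2) h0 3
  simp [Nat.factorial] at h1 h2 h3
  refine ⟨by linarith, ?_, ?_, Real.one_le_exp h0⟩
  · have : s ^ 2 = 8 * ((s / 2) ^ 2 / 2) := by ring
    rw [this]; linarith
  · have : s ^ 3 = 48 * ((s / 2) ^ 3 / 6) := by ring
    rw [this]; linarith

set_option maxHeartbeats 1000000 in
lemma pointwise (a K : ℝ) (ha : 0 ≤ a) (hK : 0 ≤ K) : ∃ C > 0, ∀ l : ℝ, 1 ≤ l → ∀ y : ℝ, |y| ≤ 1 / 2 →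
    ∀ R : ℂ, ‖R - 1‖ ≤ K / l →
    ‖cexp (a * log (1 + y * I) - l * y ^ 2 / (1 + y * I)) * R -
      Real.exp (-l * y ^ 2) * (1 + (a * y + l * y ^ 3) * I)‖ ≤
      C / l * Real.exp (-(l / 4) * y ^ 2) := by
  refine ⟨Real.exp a * K + (Real.exp a + 2) * (16 * a ^ 2 + 96) + 2 * a + 8, by positivity, ?_⟩
  intro l hl y hy R hR
  have hl0 : 0 < l := by linarith
  have hy2 : y ^ 2 ≤ 1 / 4 := by
    rw [← sq_abs]; nlinarith [abs_nonneg y]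
  have hz0 : (1 + y * I : ℂ) ≠ 0 := by
    intro h
    have := congrArg Complex.re h
    simp at this
  have hlog := log_bound hy
  have hlogn : ‖log (1 + y * I)‖ ≤ 2 * |y| := by
    have h1 : ‖log (1 + y * I)‖ ≤ ‖log (1 + y * I) - y * I‖ + ‖(y * I : ℂ)‖ := by
      simpa using norm_add_le (log (1 + y * I) - y * I) (y * I)
    have hn : ‖(y * I : ℂ)‖ = |y| := by simp
    rw [hn] at h1
    rw [← sq_abs] at hlog
    nlinarith [abs_nonneg y]
  have hzn : 1 ≤ ‖(1 + y * I : ℂ)‖ := by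
    have := Complex.abs_re_le_norm (1 + y * I : ℂ)
    simpa using this
  set X : ℂ := a * log (1 + y * I) + l * y ^ 3 * I / (1 + y * I) with hX
  have hE : cexp (a * log (1 + y * I) - l * y ^ 2 / (1 + y * I)) = Real.exp (-l * y ^ 2) * cexp X := by
    rw [Complex.ofReal_exp, ← Complex.exp_add, hX]
    congr 1
    push_cast
    field_simp
    linear_combination (0 : ℂ) * I_sq
  have hXre : X.re ≤ a + l * y ^ 2 / 4 := by
    have h1 : (a * log (1 + y * I) : ℂ).re ≤ a := by
      rw [Complex.re_ofReal_mul]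
      have := (Complex.re_le_norm _).trans hlogn
      nlinarith
    have h2 : (l * y ^ 3 * I / (1 + y * I) : ℂ).re ≤ l * y ^ 2 / 4 := by
      have e : (l * y ^ 3 * I / (1 + y * I) : ℂ) = ((l * y ^ 3 / (1 + y ^ 2) : ℝ) : ℂ) * (y + I) := by
        have h5 : (1 + y ^ 2 : ℂ) ≠ 0 := by
          have : (1 + y ^ 2 : ℝ) ≠ 0 := by positivity
          exact_mod_cast this
        push_cast
        field_simp
        linear_combination (-l * y ^ 4 : ℂ) * I_sq
      rw [e, Complex.re_ofReal_mul]
      simp only [add_re, ofReal_re, I_re, add_zero]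
      rw [div_mul_eq_mul_div, div_le_iff₀ (by positivity)]
      have h6 : y ^ 4 ≤ y ^ 2 / 4 := by nlinarith [sq_nonneg y]
      have h7 : l * y ^ 3 * y = l * y ^ 4 := by ring
      rw [h7]
      have h8 : 0 ≤ l * y ^ 4 := by positivity
      nlinarith
    rw [hX, add_re]
    linarith
  have hXu : ‖X - (a * y + l * y ^ 3) * I‖ ≤ a * y ^ 2 + l * y ^ 4 := by
    have e : X - (a * y + l * y ^ 3) * I =
        a * (log (1 + y * I) - y * I) + (l * y ^ 4 : ℝ) * (1 / (1 + y * I)) := by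
      rw [hX]; push_cast
      field_simp
      linear_combination (-l * y ^ 4 : ℂ) * I_sq
    rw [e]
    refine (norm_add_le _ _).trans ?_
    rw [norm_mul, norm_mul, Complex.norm_of_nonneg ha, Complex.norm_of_nonneg (by positivity),
      norm_div, norm_one]
    have h1 : 1 / ‖(1 + y * I : ℂ)‖ ≤ 1 := by
      rw [div_le_one (by linarith)]; exact hzn
    have h2 : 0 ≤ l * y ^ 4 := by positivity
    have h3 := mul_le_mul_of_nonneg_left h1 h2
    have h4 := mul_le_mul_of_nonneg_left hlog ha
    linarith
  have hXn : ‖X‖ ≤ 2 * a * |y| + l * |y| ^ 3 := by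
    rw [hX]
    refine (norm_add_le _ _).trans ?_
    rw [norm_mul, norm_div, norm_mul, norm_mul, norm_pow, Complex.norm_of_nonneg ha,
      Complex.norm_of_nonneg hl0.le, norm_I, mul_one, Complex.norm_real, Real.norm_eq_abs]
    have h1 : l * |y| ^ 3 / ‖(1 + y * I : ℂ)‖ ≤ l * |y| ^ 3 :=
      div_le_self (by positivity) hzn
    nlinarith
  have hXn2 : ‖X‖ ^ 2 ≤ 8 * a ^ 2 * y ^ 2 + 2 * l ^ 2 * y ^ 6 := by
    have h1 : ‖X‖ ^ 2 ≤ (2 * a * |y| + l * |y| ^ 3) ^ 2 := by gcongr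
    have h2 : (2 * a * |y| + l * |y| ^ 3) ^ 2 ≤ 2 * (2 * a * |y|) ^ 2 + 2 * (l * |y| ^ 3) ^ 2 := by
      nlinarith [sq_nonneg (2 * a * |y| - l * |y| ^ 3)]
    have h3 : 2 * (2 * a * |y|) ^ 2 + 2 * (l * |y| ^ 3) ^ 2 = 8 * a ^ 2 * y ^ 2 + 2 * l ^ 2 * y ^ 6 := by
      have e1 : (2 * a * |y|) ^ 2 = 4 * a ^ 2 * |y| ^ 2 := by ring
      have e2 : (l * |y| ^ 3) ^ 2 = l ^ 2 * (|y| ^ 2) ^ 3 := by ring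
      rw [e1, e2, sq_abs]; ring
    linarith
  set s := l * y ^ 2 with hs
  have hs0 : 0 ≤ s := by positivity
  obtain ⟨p1, p2, p3, p4⟩ := poly_bound hs0
  rw [hE]
  have e : (Real.exp (-l * y ^ 2) : ℂ) * cexp X * R -
      Real.exp (-l * y ^ 2) * (1 + (a * y + l * y ^ 3) * I) =
      Real.exp (-l * y ^ 2) * (cexp X * (R - 1) + (cexp X - 1 - X) + (X - (a * y + l * y ^ 3) * I)) := by
    ring
  rw [e, norm_mul, Complex.norm_of_nonneg (Real.exp_pos _).le]
  have hexpX : Real.exp X.re ≤ Real.exp a * Real.exp (s / 4) := by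
    rw [← Real.exp_add]; exact Real.exp_le_exp.2 (by linarith)
  have q4 : 1 ≤ Real.exp (s / 4) := Real.one_le_exp (by linarith)
  have b1 : ‖cexp X * (R - 1)‖ ≤ Real.exp a * Real.exp (s / 4) * (K / l) := by
    rw [norm_mul, Complex.norm_exp]
    gcongr
  have b2 : ‖cexp X - 1 - X‖ ≤ (Real.exp a + 2) * Real.exp (s / 4) * ((8 * a ^ 2 * s + 2 * s ^ 3) / l) := by
    refine (exp_sub_bound X).trans ?_
    have : (8 * a ^ 2 * s + 2 * s ^ 3) / l = 8 * a ^ 2 * y ^ 2 + 2 * l ^ 2 * y ^ 6 := by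
      rw [hs]; field_simp
    rw [this]
    gcongr
    nlinarith
  have b3 : ‖X - (a * y + l * y ^ 3) * I‖ ≤ Real.exp (s / 4) * ((a * s + s ^ 2) / l) := by
    have : (a * s + s ^ 2) / l = a * y ^ 2 + l * y ^ 4 := by
      rw [hs]; field_simp
    rw [this]
    refine hXu.trans ?_
    exact le_mul_of_one_le_left (by positivity) q4
  have hsum : ‖cexp X * (R - 1) + (cexp X - 1 - X) + (X - (a * y + l * y ^ 3) * I)‖ ≤
      Real.exp (s / 4) / l * (Real.exp a * K + (Real.exp a + 2) * (8 * a ^ 2 * s + 2 * s ^ 3) +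
        (a * s + s ^ 2)) := by
    refine (norm_add_le _ _).trans ?_
    refine (add_le_add_left (norm_add_le _ _) _).trans ?_
    refine (add_le_add (add_le_add b1 b2) b3).trans (le_of_eq ?_)
    field_simp
  have hin : (Real.exp a * K + (Real.exp a + 2) * (8 * a ^ 2 * s + 2 * s ^ 3) + (a * s + s ^ 2)) ≤
      (Real.exp a * K + (Real.exp a + 2) * (16 * a ^ 2 + 96) + 2 * a + 8) * Real.exp (s / 2) := by
    have i1 : Real.exp a * K ≤ Real.exp a * K * Real.exp (s / 2) :=
      le_mul_of_one_le_right (by positivity) p4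
    have i2 : 8 * a ^ 2 * s + 2 * s ^ 3 ≤ (16 * a ^ 2 + 96) * Real.exp (s / 2) := by
      have i5 := mul_le_mul_of_nonneg_left p1 (by positivity : 0 ≤ 8 * a ^ 2)
      linarith only [i5, p3]
    have i3 := mul_le_mul_of_nonneg_left i2 (by positivity : 0 ≤ Real.exp a + 2)
    have i4 := mul_le_mul_of_nonneg_left p1 ha
    have e5 : (Real.exp a * K + (Real.exp a + 2) * (16 * a ^ 2 + 96) + 2 * a + 8) * Real.exp (s / 2) =
        Real.exp a * K * Real.exp (s / 2) + (Real.exp a + 2) * ((16 * a ^ 2 + 96) * Real.exp (s / 2)) +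
        a * (2 * Real.exp (s / 2)) + 8 * Real.exp (s / 2) := by ring
    rw [e5]
    linarith only [i1, i3, i4, p2]
  calc Real.exp (-l * y ^ 2) * _ ≤ Real.exp (-l * y ^ 2) * (Real.exp (s / 4) / l *
        ((Real.exp a * K + (Real.exp a + 2) * (16 * a ^ 2 + 96) + 2 * a + 8) * Real.exp (s / 2))) := by
        gcongr
        exact hsum.trans (by gcongr)
    _ = (Real.exp a * K + (Real.exp a + 2) * (16 * a ^ 2 + 96) + 2 * a + 8) / l *
        (Real.exp (-l * y ^ 2) * Real.exp (s / 4) * Real.exp (s / 2)) := by ring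
    _ = _ := by
        rw [← Real.exp_add, ← Real.exp_add]
        congr 2
        rw [hs]; ring

end CO


namespace CO
open Finset Filter Topology Complex MeasureTheory
open scoped Real

lemma gauss4 {l : ℝ} (hl : 0 < l) : ∫ x : ℝ, Real.exp (-(l / 4) * x ^ 2) = 2 * √(π / l) := by
  rw [integral_gaussian]
  have : π / (l / 4) = 2 ^ 2 * (π / l) := by field_simp; norm_num
  rw [this, Real.sqrt_mul (by norm_num), Real.sqrt_sq (by norm_num)]

lemma gauss4_le {l : ℝ} (hl : 0 < l) (s : Set ℝ) :
    ∫ x in s, Real.exp (-(l / 4) * x ^ 2) ≤ 2 * √(π / l) := by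
  rw [← gauss4 hl]
  exact setIntegral_le_integral (integrable_exp_neg_mul_sq (by positivity))
    (Eventually.of_forall fun x => (Real.exp_pos _).le)

lemma gauss_tail {l : ℝ} (hl : 1 ≤ l) :
    |(∫ y in (-1 / 2 : ℝ)..(1 / 2), Real.exp (-l * y ^ 2)) - √(π / l)| ≤ 16 / l * √(π / l) := by
  have hl0 : 0 < l := by linarith
  have hint : Integrable fun x : ℝ => Real.exp (-l * x ^ 2) := integrable_exp_neg_mul_sq hl0
  have hint4 : Integrable fun x : ℝ => Real.exp (-(l / 4) * x ^ 2) :=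
    integrable_exp_neg_mul_sq (by positivity)
  rw [intervalIntegral.integral_of_le (by norm_num), ← integral_gaussian,
    ← integral_add_compl (measurableSet_Ioc (a := (-1 / 2 : ℝ)) (b := 1 / 2)) hint]
  rw [sub_add_cancel_left, abs_neg, abs_of_nonneg (integral_nonneg fun x => (Real.exp_pos _).le)]
  rw [integral_add_compl (measurableSet_Ioc (a := (-1 / 2 : ℝ)) (b := 1 / 2)) hint, integral_gaussian]
  calc ∫ x in (Set.Ioc (-1 / 2 : ℝ) (1 / 2))ᶜ, Real.exp (-l * x ^ 2)
      ≤ ∫ x in (Set.Ioc (-1 / 2 : ℝ) (1 / 2))ᶜ, 8 / l * Real.exp (-(l / 4) * x ^ 2) := by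
        refine setIntegral_mono_on hint.integrableOn (hint4.const_mul _).integrableOn
          measurableSet_Ioc.compl ?_
        intro y hy
        have hy2 : 1 / 4 ≤ y ^ 2 := by
          simp only [Set.mem_compl_iff, Set.mem_Ioc, not_and, not_le] at hy
          by_cases h : -1 / 2 < y
          · have := hy h; nlinarith
          · push Not at h; nlinarith
        have hs0 : 0 < l * y ^ 2 := by positivity
        obtain ⟨p1, -⟩ := poly_bound hs0.le
        have e1 : Real.exp (-(l / 4) * y ^ 2) =
            Real.exp (-l * y ^ 2) * (Real.exp (l * y ^ 2 / 2) * Real.exp (l * y ^ 2 / 4)) := by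
          rw [← Real.exp_add, ← Real.exp_add]; congr 1; ring
        have q : 1 ≤ Real.exp (l * y ^ 2 / 4) := Real.one_le_exp (by linarith)
        have h3 : l / 8 ≤ Real.exp (l * y ^ 2 / 2) := by nlinarith
        have h4 : l / 8 ≤ Real.exp (l * y ^ 2 / 2) * Real.exp (l * y ^ 2 / 4) := by nlinarith
        rw [e1]
        have h5 : 1 ≤ 8 / l * (Real.exp (l * y ^ 2 / 2) * Real.exp (l * y ^ 2 / 4)) := by
          rw [div_mul_eq_mul_div, le_div_iff₀ hl0]; linarith
        have := mul_le_mul_of_nonneg_left h5 (Real.exp_pos (-l * y ^ 2)).le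
        linarith
    _ = 8 / l * ∫ x in (Set.Ioc (-1 / 2 : ℝ) (1 / 2))ᶜ, Real.exp (-(l / 4) * x ^ 2) :=
        integral_const_mul _ _
    _ ≤ 8 / l * (2 * √(π / l)) := by gcongr; exact gauss4_le hl0 _
    _ = _ := by ring

lemma laplace (a K : ℝ) (ha : 0 ≤ a) (hK : 0 ≤ K) : ∃ C > 0, ∀ l : ℝ, 1 ≤ l → ∀ G : ℝ → ℂ,
    IntervalIntegrable G volume (-1 / 2) (1 / 2) →
    (∀ y : ℝ, |y| ≤ 1 / 2 → ∃ R : ℂ, ‖R - 1‖ ≤ K / l ∧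
      G y = cexp (a * log (1 + y * I) - l * y ^ 2 / (1 + y * I)) * R) →
    ‖(∫ y in (-1 / 2 : ℝ)..(1 / 2), G y) - (√(π / l) : ℝ)‖ ≤ C / l * √(π / l) := by
  obtain ⟨C, hC, h⟩ := pointwise a K ha hK
  refine ⟨2 * C + 16, by positivity, ?_⟩
  intro l hl G hG hGe
  have hl0 : 0 < l := by linarith
  set H : ℝ → ℂ := fun y => Real.exp (-l * y ^ 2) * (1 + (a * y + l * y ^ 3) * I) with hH
  have hHc : Continuous H := by fun_prop
  have hodd : ∫ y in (-1 / 2 : ℝ)..(1 / 2), (Real.exp (-l * y ^ 2) * ((a * y + l * y ^ 3) * I) : ℂ) = 0 := by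
    have := intervalIntegral.integral_comp_neg (a := (-1/2 : ℝ)) (b := 1 / 2)
      (f := fun y : ℝ => (Real.exp (-l * y ^ 2) * ((a * y + l * y ^ 3) * I) : ℂ))
    have e1 : -(-1 / 2 : ℝ) = 1 / 2 := by norm_num
    have e2 : (-(1 / 2) : ℝ) = -1 / 2 := by norm_num
    rw [e1, e2] at this
    have e3 : ∀ y : ℝ, (Real.exp (-l * (-y) ^ 2) * ((a * (-y : ℝ) + l * (-y : ℝ) ^ 3) * I) : ℂ) =
        -(Real.exp (-l * y ^ 2) * ((a * y + l * y ^ 3) * I)) := by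
      intro y; rw [neg_sq]; push_cast; ring
    simp only [e3] at this
    rw [intervalIntegral.integral_neg] at this
    exact self_eq_neg.1 this.symm
  have hHi : ∫ y in (-1 / 2 : ℝ)..(1 / 2), H y =
      ((∫ y in (-1 / 2 : ℝ)..(1 / 2), Real.exp (-l * y ^ 2) : ℝ) : ℂ) := by
    have : ∀ y : ℝ, H y = ((Real.exp (-l * y ^ 2) : ℝ) : ℂ) +
        (Real.exp (-l * y ^ 2) * ((a * y + l * y ^ 3) * I) : ℂ) := by
      intro y; rw [hH]; ring
    simp only [this]
    rw [intervalIntegral.integral_add, hodd, add_zero, intervalIntegral.integral_ofReal]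
    · apply Continuous.intervalIntegrable; fun_prop
    · apply Continuous.intervalIntegrable; fun_prop
  have h1 : ‖(∫ y in (-1 / 2 : ℝ)..(1 / 2), G y) - ∫ y in (-1 / 2 : ℝ)..(1 / 2), H y‖ ≤
      C / l * (2 * √(π / l)) := by
    rw [← intervalIntegral.integral_sub hG (hHc.intervalIntegrable _ _)]
    refine (intervalIntegral.norm_integral_le_of_norm_le
      (g := fun y => C / l * Real.exp (-(l / 4) * y ^ 2)) (by norm_num) ?_ ?_).trans ?_
    · refine Eventually.of_forall fun y hy => ?_
      have hy' : |y| ≤ 1 / 2 := abs_le.2 ⟨by linarith [hy.1], hy.2⟩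
      obtain ⟨R, hR, e⟩ := hGe y hy'
      rw [e]
      exact h l hl y hy' R hR
    · apply Continuous.intervalIntegrable; fun_prop
    · rw [intervalIntegral.integral_const_mul]
      gcongr
      rw [intervalIntegral.integral_of_le (by norm_num)]
      exact gauss4_le hl0 _
  have h2 := gauss_tail hl
  have h3 : ‖(∫ y in (-1 / 2 : ℝ)..(1 / 2), H y) - (√(π / l) : ℝ)‖ ≤ 16 / l * √(π / l) := by
    rw [hHi, ← Complex.ofReal_sub, Complex.norm_real]; exact h2
  have := norm_sub_le_norm_sub_add_norm_sub (∫ y in (-1 / 2 : ℝ)..(1 / 2), G y)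
    (∫ y in (-1 / 2 : ℝ)..(1 / 2), H y) ((√(π / l) : ℝ) : ℂ)
  refine (this.trans (add_le_add h1 h3)).trans (le_of_eq ?_)
  ring

end CO


namespace CO
open Finset Filter Topology Complex MeasureTheory
open scoped Real

noncomputable def Phi (k j n : ℕ) (t0 θ : ℝ) : ℂ :=
  FF k j (cexp (-(t0 + θ * I))) * cexp (n * (t0 + θ * I))

lemma exp_int (m : ℤ) (hm : m ≠ 0) : ∫ θ in (-π)..π, cexp (m * I * θ) = 0 := by
  have hc : (m * I : ℂ) ≠ 0 := mul_ne_zero (by exact_mod_cast hm) I_ne_zero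
  rw [integral_exp_mul_complex hc]
  have : cexp (m * I * (π : ℝ)) = cexp (m * I * ((-π : ℝ) : ℂ)) := by
    rw [Complex.exp_eq_exp_iff_exists_int]
    exact ⟨m, by push_cast; ring⟩
  rw [this, sub_self, zero_div]

lemma phi_sum (k j n : ℕ) (hjk : j ≤ k) {t0 : ℝ} (h0 : 0 < t0) (θ : ℝ) :
    HasSum (fun m : ℕ => (cnt k j m : ℂ) * cexp (-(t0 + θ * I)) ^ m * cexp (n * (t0 + θ * I)))
      (Phi k j n t0 θ) := by
  have hq : ‖cexp (-(t0 + θ * I))‖ < 1 := norm_exp_neg_lt (by simpa using h0)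
  exact (gen_fun k j hjk hq).2.mul_right _

lemma phi_bd (k j n : ℕ) (t0 θ : ℝ) (m : ℕ) :
    ‖(cnt k j m : ℂ) * cexp (-(t0 + θ * I)) ^ m * cexp (n * (t0 + θ * I))‖ =
      ‖(cnt k j m : ℂ) * cexp (-(t0 : ℂ)) ^ m‖ * Real.exp (n * t0) := by
  rw [norm_mul, norm_mul, norm_mul, norm_pow, norm_pow, Complex.norm_exp, Complex.norm_exp,
    Complex.norm_exp]
  simp

lemma phi_summ (k j n : ℕ) (hjk : j ≤ k) {t0 : ℝ} (h0 : 0 < t0) :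
    Summable (fun m : ℕ => ‖(cnt k j m : ℂ) * cexp (-(t0 : ℂ)) ^ m‖ * Real.exp (n * t0)) :=
  (gen_fun k j hjk (norm_exp_neg_lt (by simpa using h0))).1.mul_right _

lemma phi_cont (k j n : ℕ) (hjk : j ≤ k) {t0 : ℝ} (h0 : 0 < t0) :
    Continuous (Phi k j n t0) := by
  have : Phi k j n t0 = fun θ : ℝ => ∑' m : ℕ,
      (cnt k j m : ℂ) * cexp (-(t0 + θ * I)) ^ m * cexp (n * (t0 + θ * I)) := by
    funext θ; exact (phi_sum k j n hjk h0 θ).tsum_eq.symm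
  rw [this]
  refine continuous_tsum (fun m => by fun_prop) (phi_summ k j n hjk h0) ?_
  intro m θ
  exact (phi_bd k j n t0 θ m).le

lemma cauchy (k j n : ℕ) (hjk : j ≤ k) {t0 : ℝ} (h0 : 0 < t0) :
    ∫ θ in (-π)..π, Phi k j n t0 θ = 2 * π * cnt k j n := by
  have h := intervalIntegral.hasSum_integral_of_dominated_convergence (a := -π) (b := π) (μ := volume)
    (F := fun (m : ℕ) (θ : ℝ) =>
      (cnt k j m : ℂ) * cexp (-(t0 + θ * I)) ^ m * cexp (n * (t0 + θ * I)))
    (f := Phi k j n t0)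
    (fun m _ => ‖(cnt k j m : ℂ) * cexp (-(t0 : ℂ)) ^ m‖ * Real.exp (n * t0))
    (fun m => Continuous.aestronglyMeasurable (by fun_prop))
    (fun m => Eventually.of_forall fun θ _ => (phi_bd k j n t0 θ m).le)
    (Eventually.of_forall fun θ _ => phi_summ k j n hjk h0)
    intervalIntegrable_const
    (Eventually.of_forall fun θ _ => phi_sum k j n hjk h0 θ)
  have e : ∀ (m : ℕ) (θ : ℝ), (cnt k j m : ℂ) * cexp (-(t0 + θ * I)) ^ m * cexp (n * (t0 + θ * I)) =
      (cnt k j m : ℂ) * cexp ((n - m) * t0) * cexp (((n - m : ℤ) : ℂ) * I * θ) := by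
    intro m θ
    rw [← Complex.exp_nat_mul, mul_assoc, mul_assoc, ← Complex.exp_add, ← Complex.exp_add]
    congr 2
    push_cast; ring
  have h2 := hasSum_single (f := fun m : ℕ => ∫ θ in (-π)..π,
      (cnt k j m : ℂ) * cexp (-(t0 + θ * I)) ^ m * cexp (n * (t0 + θ * I))) n (by
    intro m hm
    simp only [e]
    rw [intervalIntegral.integral_const_mul, exp_int, mul_zero]
    omega)
  rw [h.unique h2]
  simp only [e]
  rw [intervalIntegral.integral_const_mul]
  simp
  ring

end CO


namespace CO
open Finset Filter Topology Complex MeasureTheory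
open scoped Real

lemma AA_pos {k : ℕ} (j : ℕ) (hk : 0 < k) : 0 < AA k j := by
  have : (0 : ℝ) < k := by exact_mod_cast hk
  unfold AA; positivity

lemma phi_tail (k j n : ℕ) (hk : 0 < k) {t0 l K : ℝ} (h0 : 0 < t0) (h1 : t0 ≤ 1 / 2)
    (hl : 0 < l) (hn : n * t0 = l) (R : ℂ) (hR : ‖R - 1‖ ≤ K) (hA : AA k j / t0 = l)
    (hF : FF k j (cexp (-(t0 * (1 + (0 : ℝ) * I)))) = M0 k j t0 *
      cexp (k / 2 * log (1 + (0 : ℝ) * I) + (AA k j / t0 : ℝ) / (1 + (0 : ℝ) * I)) * R)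
    (θ : ℝ) (hθ : t0 / 2 ≤ |θ|) (hθ' : |θ| ≤ π) :
    ‖Phi k j n t0 θ‖ ≤ M0 k j t0 * Real.exp (2 * l) * ((1 + K) * Real.exp (-(0.01 / t0))) := by
  have hq : ‖cexp (-(t0 + θ * I))‖ < 1 := norm_exp_neg_lt (by simpa using h0)
  have hu := FF_upper hq k j hk (0.01 / t0) (by positivity) (gain h0 h1 hθ hθ')
  have hnq : ‖cexp (-(t0 + θ * I))‖ = Real.exp (-t0) := by
    rw [Complex.norm_exp]; simp
  rw [hnq] at hu
  have hF' : ‖FF k j (Real.exp (-t0) : ℝ)‖ ≤ M0 k j t0 * Real.exp l * (1 + K) := by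
    have e : ((Real.exp (-t0) : ℝ) : ℂ) = cexp (-(t0 * (1 + (0 : ℝ) * I))) := by
      push_cast; simp
    rw [e, hF, norm_mul, norm_mul, hA]
    have e1 : (k / 2 * log (1 + (0 : ℝ) * I) + (l : ℝ) / (1 + (0 : ℝ) * I) : ℂ) = (l : ℝ) := by simp
    have hM : 0 ≤ M0 k j t0 := (Real.exp_pos _).le
    rw [e1, Complex.norm_of_nonneg hM, Complex.norm_exp, Complex.ofReal_re]
    gcongr
    have := norm_add_le (R - 1) 1
    simp at this
    linarith
  unfold Phi
  rw [norm_mul]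
  have e2 : ‖cexp (n * (t0 + θ * I))‖ = Real.exp l := by
    rw [Complex.norm_exp]; simp [hn]
  rw [e2]
  calc _ ≤ M0 k j t0 * Real.exp l * (1 + K) * Real.exp (-(0.01 / t0)) * Real.exp l := by
        gcongr
        exact hu.trans (by gcongr)
    _ = _ := by
        rw [two_mul, Real.exp_add]; ring

lemma exp_small {c l : ℝ} (hc : 0 < c) (hl : 1 ≤ l) :
    Real.exp (-(c * l)) ≤ 6 / c ^ 3 / l ^ 2 * √(π / l) := by
  have hl0 : 0 < l := by linarith
  have h3 := Real.pow_div_factorial_le_exp (c * l) (by positivity) 3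
  have h4 : 1 / l ≤ √(π / l) := by
    apply Real.le_sqrt_of_sq_le
    rw [div_pow, one_pow, div_le_div_iff₀ (by positivity) hl0]
    nlinarith [Real.pi_gt_three]
  have h5 : Real.exp (-(c * l)) ≤ 6 / (c * l) ^ 3 := by
    rw [Real.exp_neg, inv_le_comm₀ (Real.exp_pos _) (by positivity), inv_div]
    simpa [Nat.factorial] using h3
  refine h5.trans ?_
  calc 6 / (c * l) ^ 3 = 6 / c ^ 3 / l ^ 2 * (1 / l) := by field_simp
    _ ≤ _ := by gcongr

lemma key (k j : ℕ) (hk : 0 < k) (hjk : j ≤ k) : ∃ C > 0, ∃ L ≥ 1, ∀ n : ℕ, ∀ l : ℝ, L ≤ l →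
    l ^ 2 = AA k j * n →
    |(cnt k j n : ℝ) - M0 k j (AA k j / l) * Real.exp (2 * l) * (AA k j / l) * √(π / l) / (2 * π)| ≤
      C / l * (M0 k j (AA k j / l) * Real.exp (2 * l) * (AA k j / l) * √(π / l) / (2 * π)) := by
  have hA := AA_pos j hk
  set A := AA k j with hAdef
  obtain ⟨K, hK, τ, hτ, hcone⟩ := FF_cone k j
  obtain ⟨C1, hC1, hlap⟩ := laplace (k / 2) (K * A) (by positivity) (by positivity)
  set c := 0.01 / A with hc
  have hc0 : 0 < c := by positivity
  refine ⟨C1 + 2 * π * (1 + K * A) * (6 / c ^ 3) / A, by positivity, 1 + A / τ + 2 * A,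
    by have : 0 < A / τ := by positivity
       linarith, ?_⟩
  intro n l hl hln
  have hAt : 0 < A / τ := by positivity
  have hl1 : 1 ≤ l := by linarith
  have hl0 : 0 < l := by linarith
  set t0 := A / l with ht0
  have h0 : 0 < t0 := by positivity
  have hτ' : t0 < τ := by
    rw [ht0, div_lt_iff₀ hl0]
    have : A / τ < l := by linarith
    rw [div_lt_iff₀ hτ] at this
    linarith
  have h12 : t0 ≤ 1 / 2 := by
    rw [ht0, div_le_iff₀ hl0]; linarith
  have hnt : (n : ℝ) * t0 = l := by
    rw [ht0]; field_simp; linarith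
  have hAl : A / t0 = l := by rw [ht0]; field_simp
  have hM : 0 < M0 k j t0 := Real.exp_pos _
  set M := M0 k j t0 * Real.exp (2 * l) with hMdef
  have hMp : 0 < M := by positivity
  set T := √(π / l) with hT
  have hT0 : 0 < T := Real.sqrt_pos.2 (by positivity)
  have hcont := phi_cont k j n hjk h0
  -- tails
  obtain ⟨R0, hR0, hF0⟩ := hcone t0 h0 hτ' 0 (by norm_num)
  have hKt : K * t0 ≤ K * A := by
    gcongr; rw [ht0]; exact div_le_self hA.le hl1
  have htail : ∀ θ : ℝ, t0 / 2 ≤ |θ| → |θ| ≤ π →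
      ‖Phi k j n t0 θ‖ ≤ M * ((1 + K * A) * (6 / c ^ 3 / l ^ 2 * T)) := by
    intro θ h1 h2
    refine (phi_tail k j n hk h0 h12 hl0 hnt R0 (hR0.trans hKt) hAl hF0 θ h1 h2).trans ?_
    have e : 0.01 / t0 = c * l := by rw [ht0, hc]; field_simp
    rw [e]
    gcongr
    exact exp_small hc0 hl1
  have hpi := Real.pi_gt_three
  set D := M * ((1 + K * A) * (6 / c ^ 3 / l ^ 2 * T)) with hD
  have hD0 : 0 ≤ D := by positivity
  have ht1 : ‖∫ θ in (-π)..(-(t0 / 2)), Phi k j n t0 θ‖ ≤ D * π := by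
    refine (intervalIntegral.norm_integral_le_of_norm_le_const (C := D) ?_).trans ?_
    · intro θ hθ
      rw [Set.uIoc_of_le (by linarith)] at hθ
      rw [Set.mem_Ioc] at hθ
      have : |θ| = -θ := abs_of_nonpos (by linarith)
      exact htail θ (by rw [this]; linarith) (by rw [this]; linarith)
    · gcongr
      rw [abs_of_nonneg (by linarith)]; linarith
  have ht2 : ‖∫ θ in (t0 / 2)..π, Phi k j n t0 θ‖ ≤ D * π := by
    refine (intervalIntegral.norm_integral_le_of_norm_le_const (C := D) ?_).trans ?_
    · intro θ hθ
      rw [Set.uIoc_of_le (by linarith)] at hθ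
      rw [Set.mem_Ioc] at hθ
      have : |θ| = θ := abs_of_nonneg (by linarith)
      exact htail θ (by rw [this]; linarith) (by rw [this]; linarith)
    · gcongr
      rw [abs_of_nonneg (by linarith)]; linarith
  -- middle
  have hMc : (M : ℂ) ≠ 0 := by exact_mod_cast hMp.ne'
  have hmid := hlap l hl1 (fun y => Phi k j n t0 (t0 * y) / M)
    (Continuous.intervalIntegrable (by fun_prop) _ _) (by
      intro y hy
      obtain ⟨R, hR, hF⟩ := hcone t0 h0 hτ' y hy
      refine ⟨R, hR.trans (le_of_eq ?_), ?_⟩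
      · rw [ht0]; ring
      · have hz0 : (1 + y * I : ℂ) ≠ 0 := by
          intro h
          have := congrArg Complex.re h
          simp at this
        have e1 : (t0 + ((t0 * y : ℝ) : ℂ) * I : ℂ) = t0 * (1 + y * I) := by push_cast; ring
        have e2 : (n * (t0 * (1 + y * I)) : ℂ) = l * (1 + y * I) := by
          rw [← mul_assoc]; congr 1; exact_mod_cast hnt
        rw [div_eq_iff hMc]
        unfold Phi
        rw [e1, hF, e2, hAl, hMdef]
        push_cast
        have e3 : (k / 2 * log (1 + y * I) + l / (1 + y * I) : ℂ) + l * (1 + y * I) =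
            (k / 2 * log (1 + y * I) - l * y ^ 2 / (1 + y * I)) + 2 * l := by
          field_simp
          linear_combination (2 * l * y ^ 2 : ℂ) * I_sq
        have e4 := congrArg cexp e3
        rw [Complex.exp_add _ (l * (1 + y * I) : ℂ), Complex.exp_add _ (2 * l : ℂ)] at e4
        linear_combination (M0 k j t0 * R : ℂ) * e4)
  have hsub : ∫ θ in (-(t0 / 2))..(t0 / 2), Phi k j n t0 θ =
      t0 * M * ∫ y in (-1 / 2 : ℝ)..(1 / 2), Phi k j n t0 (t0 * y) / M := by
    have := intervalIntegral.smul_integral_comp_mul_left (a := (-1/2 : ℝ)) (b := 1 / 2)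
      (Phi k j n t0) t0
    have e1 : t0 * (-1 / 2) = -(t0 / 2) := by ring
    have e2 : t0 * (1 / 2) = t0 / 2 := by ring
    rw [e1, e2] at this
    rw [← this, intervalIntegral.integral_div, Complex.real_smul]
    field_simp
  have hii : ∀ a b : ℝ, IntervalIntegrable (Phi k j n t0) volume a b :=
    fun a b => hcont.intervalIntegrable a b
  have hsplit : (2 * π * cnt k j n : ℂ) = (∫ θ in (-π)..(-(t0 / 2)), Phi k j n t0 θ) +
      (∫ θ in (-(t0 / 2))..(t0 / 2), Phi k j n t0 θ) + ∫ θ in (t0 / 2)..π, Phi k j n t0 θ := by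
    rw [← cauchy k j n hjk h0, intervalIntegral.integral_add_adjacent_intervals (hii _ _) (hii _ _),
      intervalIntegral.integral_add_adjacent_intervals (hii _ _) (hii _ _)]
  have hfin : ‖(2 * π * cnt k j n : ℂ) - (t0 * M : ℝ) * (T : ℝ)‖ ≤ D * π + t0 * M * (C1 / l * T) + D * π := by
    rw [hsplit, hsub]
    set X := ∫ y in (-1 / 2 : ℝ)..(1 / 2), Phi k j n t0 (t0 * y) / M
    set Y1 := ∫ θ in (-π)..(-(t0 / 2)), Phi k j n t0 θ
    set Y2 := ∫ θ in (t0 / 2)..π, Phi k j n t0 θ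
    have e : Y1 + t0 * M * X + Y2 - (t0 * M : ℝ) * (T : ℝ) = Y1 + (t0 * M : ℝ) * (X - (T : ℝ)) + Y2 := by
      push_cast; ring
    rw [e]
    have h3 : ‖((t0 * M : ℝ) : ℂ) * (X - (T : ℝ))‖ ≤ t0 * M * (C1 / l * T) := by
      rw [norm_mul, Complex.norm_of_nonneg (by positivity)]
      gcongr
    exact (norm_add₃_le).trans (add_le_add (add_le_add ht1 h3) ht2)
  have hreal : ‖(2 * π * cnt k j n : ℂ) - (t0 * M : ℝ) * (T : ℝ)‖ = |2 * π * cnt k j n - t0 * M * T| := by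
    rw [← Real.norm_eq_abs, ← Complex.norm_real]; push_cast; rfl
  rw [hreal] at hfin
  have e5 : (cnt k j n : ℝ) - M * t0 * T / (2 * π) = (2 * π * cnt k j n - t0 * M * T) / (2 * π) := by
    field_simp
  rw [e5, abs_div, abs_of_pos (by positivity : 0 < 2 * π), div_le_iff₀ (by positivity)]
  refine hfin.trans (le_of_eq ?_)
  rw [hD, ht0]
  field_simp
  ring

end CO


namespace CO
open Finset Filter Topology MeasureTheory
open scoped Real

lemma main_eq (k j n : ℕ) (hk : 0 < k) (hn : 0 < n) (l : ℝ) (hl : l = √(AA k j * n)) :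
    M0 k j (AA k j / l) * Real.exp (2 * l) * (AA k j / l) * √(π / l) / (2 * π) =
    ((2 * k + j : ℝ) ^ (((k : ℝ) + 1) / 4) /
              ((2 : ℝ) ^ ((2 * (k : ℝ) + j + 3) / 2) * (3 : ℝ) ^ (((k : ℝ) + 1) / 4) *
                (n : ℝ) ^ (((k : ℝ) + 3) / 4)) *
            Real.exp (Real.pi * Real.sqrt ((2 * k + j : ℝ) * n / 3))) := by
  have hA := AA_pos j hk
  have hn0 : (0 : ℝ) < n := by exact_mod_cast hn
  have hk0 : (0 : ℝ) < k := by exact_mod_cast hk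
  have hm : (0 : ℝ) < 2 * k + j := by positivity
  have hl0 : 0 < l := by rw [hl]; positivity
  have hpi := Real.pi_pos
  have e1 : 2 * l = Real.pi * Real.sqrt ((2 * k + j : ℝ) * n / 3) := by
    have : AA k j * n = (π / 2) ^ 2 * ((2 * k + j : ℝ) * n / 3) := by unfold AA; ring
    rw [hl, this, Real.sqrt_mul (by positivity), Real.sqrt_sq (by positivity)]; ring
  have hlogA : Real.log (AA k j) = 2 * Real.log π + Real.log (2 * k + j) - (2 * Real.log 2 + Real.log 3) := by
    unfold AA
    rw [Real.log_div (by positivity) (by norm_num), Real.log_mul (by positivity) hm.ne', Real.log_pow,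
      show (12 : ℝ) = 2 ^ 2 * 3 by norm_num, Real.log_mul (by norm_num) (by norm_num), Real.log_pow]
    push_cast; ring
  have hlogl : Real.log l = (Real.log (AA k j) + Real.log n) / 2 := by
    rw [hl, Real.log_sqrt (by positivity), Real.log_mul hA.ne' hn0.ne']
  rw [← e1]
  rw [← Real.exp_log (show 0 < M0 k j (AA k j / l) * Real.exp (2 * l) * (AA k j / l) * √(π / l) / (2 * π) by
    unfold M0; positivity)]
  rw [Real.rpow_def_of_pos hm, Real.rpow_def_of_pos two_pos, Real.rpow_def_of_pos three_pos,
    Real.rpow_def_of_pos hn0, ← Real.exp_add, ← Real.exp_add, ← Real.exp_sub, ← Real.exp_add]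
  congr 1
  have hM : M0 k j (AA k j / l) ≠ 0 := (Real.exp_pos _).ne'
  have hs : √(π / l) ≠ 0 := by positivity
  have hAl : AA k j / l ≠ 0 := by positivity
  rw [Real.log_div (by positivity) (by positivity), Real.log_mul (by positivity) hs,
    Real.log_mul (by positivity) hAl, Real.log_mul hM (Real.exp_pos _).ne', Real.log_exp,
    Real.log_sqrt (by positivity), Real.log_div hpi.ne' hl0.ne', Real.log_div hA.ne' hl0.ne',
    Real.log_mul two_ne_zero hpi.ne']
  unfold M0
  rw [Real.log_exp, Real.log_div hAl (by positivity), Real.log_div hA.ne' hl0.ne',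
    Real.log_mul two_ne_zero hpi.ne', hlogl, hlogA]
  ring

lemma final (k j : ℕ) (hj : 0 < j) (hjk : j ≤ k) :
    ∃ C > (0 : ℝ), ∃ N : ℕ, ∀ n : ℕ, N ≤ n →
      |(Nat.card (ColouredOverpartition k j n) : ℝ) -
          ((2 * k + j : ℝ) ^ (((k : ℝ) + 1) / 4) /
              ((2 : ℝ) ^ ((2 * (k : ℝ) + j + 3) / 2) * (3 : ℝ) ^ (((k : ℝ) + 1) / 4) *
                (n : ℝ) ^ (((k : ℝ) + 3) / 4)) *
            Real.exp (Real.pi * Real.sqrt ((2 * k + j : ℝ) * n / 3)))|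
        ≤ C * (n : ℝ) ^ (-(1 : ℝ) / 2) *
            ((2 * k + j : ℝ) ^ (((k : ℝ) + 1) / 4) /
              ((2 : ℝ) ^ ((2 * (k : ℝ) + j + 3) / 2) * (3 : ℝ) ^ (((k : ℝ) + 1) / 4) *
                (n : ℝ) ^ (((k : ℝ) + 3) / 4)) *
            Real.exp (Real.pi * Real.sqrt ((2 * k + j : ℝ) * n / 3))) := by
  have hk : 0 < k := by omega
  have hA := AA_pos j hk
  obtain ⟨C, hC, L, hL, h⟩ := key k j hk hjk
  refine ⟨C / √(AA k j), by positivity, ⌈L ^ 2 / AA k j⌉₊ + 1, ?_⟩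
  intro n hn
  have hn1 : 0 < n := by omega
  have hn0 : (0 : ℝ) < n := by exact_mod_cast hn1
  have hLn : L ^ 2 ≤ AA k j * n := by
    have h1 : L ^ 2 / AA k j ≤ n := (Nat.le_ceil _).trans (by exact_mod_cast (by omega))
    rw [div_le_iff₀ hA] at h1
    linarith
  have := h n (√(AA k j * n)) (Real.le_sqrt_of_sq_le hLn) (Real.sq_sqrt (by positivity))
  rw [main_eq k j n hk hn1 _ rfl] at this
  have e : C / √(AA k j * n) = C / √(AA k j) * (n : ℝ) ^ (-(1 : ℝ) / 2) := by
    rw [Real.sqrt_mul hA.le, neg_div, Real.rpow_neg hn0.le, ← Real.sqrt_eq_rpow]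
    field_simp
  rw [e] at this
  exact this

end CO


/-- Hardy–Ramanujan type asymptotic for `(k,j)`-coloured overpartitions:
`p̄_{k,j}(n) = (2k+j)^{(k+1)/4} / (2^{(2k+j+3)/2} 3^{(k+1)/4} n^{(k+3)/4})
  · e^{π√((2k+j)n/3)} (1 + O(n^{−1/2}))`. -/
theorem coloured_overpartition_asymptotic (k j : ℕ) (hj : 0 < j) (hjk : j ≤ k) :
    ∃ C > (0 : ℝ), ∃ N : ℕ, ∀ n : ℕ, N ≤ n →
      |(Nat.card (ColouredOverpartition k j n) : ℝ) -
          ((2 * k + j : ℝ) ^ (((k : ℝ) + 1) / 4) /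
              ((2 : ℝ) ^ ((2 * (k : ℝ) + j + 3) / 2) * (3 : ℝ) ^ (((k : ℝ) + 1) / 4) *
                (n : ℝ) ^ (((k : ℝ) + 3) / 4)) *
            Real.exp (Real.pi * Real.sqrt ((2 * k + j : ℝ) * n / 3)))|
        ≤ C * (n : ℝ) ^ (-(1 : ℝ) / 2) *
            ((2 * k + j : ℝ) ^ (((k : ℝ) + 1) / 4) /
              ((2 : ℝ) ^ ((2 * (k : ℝ) + j + 3) / 2) * (3 : ℝ) ^ (((k : ℝ) + 1) / 4) *
                (n : ℝ) ^ (((k : ℝ) + 3) / 4)) *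
            Real.exp (Real.pi * Real.sqrt ((2 * k + j : ℝ) * n / 3))) := by
  exact CO.final k j hj hjk
end
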